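/- Let n ≥ 1, s > 0 and α₀ with n − 2s ≤ α₀ < n. Suppose that for every α with α₀ < α ≤ n there is a constant C_α such that ∫ sup_{0<t<1} |e^{itΔ} u₀(x)| dμ(x) ≤ C_α √(c_α(μ) · μ(ℝⁿ)) ‖u₀‖_{H^s(ℝⁿ)} for every Schwartz function u₀ and every α-dimensional measure μ on ℝⁿ. Then for every u₀ ∈ H^s(ℝⁿ), the divergence set satisfies dim_H D(u₀) ≤ α₀. -/

import Mathlib

open MeasureTheory Metric Filter Set
open scoped ENNReal InnerProductSpace Topology

noncomputable def cAlpha (n : ℕ) (α : ℝ) (μ : Measure (EuclideanSpace ℝ (Fin n))) : ℝ≥0∞ :=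
  ⨆ (x : EuclideanSpace ℝ (Fin n)) (r : ℝ) (_ : 0 < r), μ (ball x r) / ENNReal.ofReal (r ^ α)

def IsAlphaDimensional (n : ℕ) (α : ℝ) (μ : Measure (EuclideanSpace ℝ (Fin n))) : Prop :=
  μ (closedBall 0 1)ᶜ = 0 ∧ cAlpha n α μ ≠ ⊤

/-- The Fourier transform `f̂(ξ) = (2π)^{-n/2} ∫ e^{-i x·ξ} f(x) dx`. -/
noncomputable def hatFn (n : ℕ) (f : EuclideanSpace ℝ (Fin n) → ℂ)
    (ξ : EuclideanSpace ℝ (Fin n)) : ℂ :=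
  (((2 * Real.pi) ^ (-(n : ℝ) / 2) : ℝ) : ℂ) *
    ∫ x, Complex.exp (-Complex.I * ((⟪x, ξ⟫_ℝ : ℝ) : ℂ)) * f x

/-- For Schwartz data, `e^{itΔ}u₀(x) = (2π)^{-n/2} ∫ û₀(ξ) e^{i(x·ξ - t|ξ|²)} dξ`. -/
noncomputable def schroEvol (n : ℕ) (u₀ : SchwartzMap (EuclideanSpace ℝ (Fin n)) ℂ)
    (t : ℝ) (x : EuclideanSpace ℝ (Fin n)) : ℂ :=
  (((2 * Real.pi) ^ (-(n : ℝ) / 2) : ℝ) : ℂ) *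
    ∫ ξ, hatFn n (⇑u₀) ξ *
      Complex.exp (Complex.I * (((⟪x, ξ⟫_ℝ : ℝ) : ℂ) - (t : ℂ) * ((‖ξ‖ ^ 2 : ℝ) : ℂ)))

/-- The `H^s` norm computed from the Fourier side: `‖(1+|·|²)^{s/2} F‖_{L²}`. -/
noncomputable def hsNormOfHat (n : ℕ) (s : ℝ) (F : EuclideanSpace ℝ (Fin n) → ℂ) : ℝ :=
  (∫ ξ, (1 + ‖ξ‖ ^ 2) ^ s * ‖F ξ‖ ^ 2) ^ ((1 : ℝ) / 2)

noncomputable def schroPartial (n : ℕ) (ψ : SchwartzMap ℝ ℝ)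
    (F : EuclideanSpace ℝ (Fin n) → ℂ) (x : EuclideanSpace ℝ (Fin n)) (t N : ℝ) : ℂ :=
  ∫ ξ, ((ψ (‖ξ‖ / N) : ℝ) : ℂ) * F ξ *
    Complex.exp (Complex.I * (((⟪x, ξ⟫_ℝ : ℝ) : ℂ) - (t : ℂ) * ((‖ξ‖ ^ 2 : ℝ) : ℂ)))

noncomputable def schroSol (n : ℕ) (ψ : SchwartzMap ℝ ℝ)
    (F : EuclideanSpace ℝ (Fin n) → ℂ) (x : EuclideanSpace ℝ (Fin n)) (t : ℝ) : ℂ :=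
  limUnder atTop (fun N : ℝ => schroPartial n ψ F x t N)

def schroDivergenceSet (n : ℕ) (ψ : SchwartzMap ℝ ℝ)
    (F : EuclideanSpace ℝ (Fin n) → ℂ) : Set (EuclideanSpace ℝ (Fin n)) :=
  {x | ¬ ((∃ L : ℂ, Tendsto (fun N : ℝ => schroPartial n ψ F x 0 N) atTop (𝓝 L)) ∧
      ∃ t₀ : ℝ, 0 < t₀ ∧
        (∀ t ∈ Ioo (0 : ℝ) t₀,
          ∃ L : ℂ, Tendsto (fun N : ℝ => schroPartial n ψ F x t N) atTop (𝓝 L)) ∧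
        Tendsto (fun t => schroSol n ψ F x t) (𝓝[>] (0 : ℝ)) (𝓝 (schroSol n ψ F x 0)))}

/-- The character `e^{i(x·ξ - t|ξ|²)}`. -/
noncomputable def schroPhase (n : ℕ) (t : ℝ) (x ξ : EuclideanSpace ℝ (Fin n)) : ℂ :=
  Complex.exp (Complex.I * (((⟪x, ξ⟫_ℝ : ℝ) : ℂ) - (t : ℂ) * ((‖ξ‖ ^ 2 : ℝ) : ℂ)))

/-- The oscillatory integral `∫ F(ξ) e^{i(x·ξ - t|ξ|²)} dξ`. -/
noncomputable def freeEvol (n : ℕ) (F : EuclideanSpace ℝ (Fin n) → ℂ) (t : ℝ)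
    (x : EuclideanSpace ℝ (Fin n)) : ℂ :=
  ∫ ξ, F ξ * schroPhase n t x ξ

section freeEvol

variable {n : ℕ} {F G : EuclideanSpace ℝ (Fin n) → ℂ}

lemma schroPhase_eq_exp_ofReal_mul_I (t : ℝ) (x ξ : EuclideanSpace ℝ (Fin n)) :
    schroPhase n t x ξ = Complex.exp (((⟪x, ξ⟫_ℝ - t * ‖ξ‖ ^ 2 : ℝ) : ℂ) * Complex.I) := by
  rw [schroPhase]; push_cast; ring_nf

@[simp] lemma norm_schroPhase (t : ℝ) (x ξ : EuclideanSpace ℝ (Fin n)) :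
    ‖schroPhase n t x ξ‖ = 1 := by
  rw [schroPhase_eq_exp_ofReal_mul_I, Complex.norm_exp_ofReal_mul_I]

lemma continuous_schroPhase_freq (t : ℝ) (x : EuclideanSpace ℝ (Fin n)) :
    Continuous (schroPhase n t x) := by
  unfold schroPhase; fun_prop

lemma schroPhase_add (t τ : ℝ) (x y ξ : EuclideanSpace ℝ (Fin n)) :
    schroPhase n (t + τ) (x + y) ξ = schroPhase n t x ξ * schroPhase n τ y ξ := by
  simp only [schroPhase, ← Complex.exp_add, inner_add_left]
  push_cast; ring_nf

lemma norm_schroPhase_sub_le (t : ℝ) (x y ξ : EuclideanSpace ℝ (Fin n)) :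
    ‖schroPhase n t x ξ - schroPhase n t y ξ‖ ≤ ‖x - y‖ * ‖ξ‖ := by
  have h : schroPhase n t x ξ = schroPhase n t y ξ * schroPhase n 0 (x - y) ξ := by
    rw [← schroPhase_add]; simp
  rw [h, ← mul_sub_one, norm_mul, norm_schroPhase, one_mul, schroPhase]
  have := Real.norm_exp_I_mul_ofReal_sub_one_le (x := ⟪x - y, ξ⟫_ℝ)
  simp only [Complex.ofReal_zero, zero_mul, sub_zero]
  exact this.trans (norm_inner_le_norm _ _)

lemma MeasureTheory.Integrable.mul_schroPhase (hF : Integrable F) (t : ℝ)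
    (x : EuclideanSpace ℝ (Fin n)) : Integrable fun ξ => F ξ * schroPhase n t x ξ := by
  refine hF.norm.mono' (hF.1.mul (continuous_schroPhase_freq t x).aestronglyMeasurable) ?_
  simp

lemma norm_freeEvol_le (F : EuclideanSpace ℝ (Fin n) → ℂ) (t : ℝ)
    (x : EuclideanSpace ℝ (Fin n)) : ‖freeEvol n F t x‖ ≤ ∫ ξ, ‖F ξ‖ := by
  refine (norm_integral_le_integral_norm _).trans_eq ?_
  simp

lemma freeEvol_sub (hF : Integrable F) (hG : Integrable G) (t : ℝ)
    (x : EuclideanSpace ℝ (Fin n)) :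
    freeEvol n (fun ξ => F ξ - G ξ) t x = freeEvol n F t x - freeEvol n G t x := by
  simp only [freeEvol, sub_mul]
  exact integral_sub (hF.mul_schroPhase t x) (hG.mul_schroPhase t x)

lemma continuous_freeEvol (hF : Integrable F) :
    Continuous fun p : ℝ × EuclideanSpace ℝ (Fin n) => freeEvol n F p.1 p.2 := by
  have h : ∀ ξ, Continuous fun p : ℝ × EuclideanSpace ℝ (Fin n) =>
      F ξ * schroPhase n p.1 p.2 ξ := by
    intro ξ
    unfold schroPhase
    fun_prop
  have h2 : ∀ p : ℝ × EuclideanSpace ℝ (Fin n),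
      ∀ᵐ ξ, ‖F ξ * schroPhase n p.1 p.2 ξ‖ ≤ ‖F ξ‖ := by
    intro p; simp
  exact continuous_of_dominated (F := fun (p : ℝ × EuclideanSpace ℝ (Fin n)) ξ =>
      F ξ * schroPhase n p.1 p.2 ξ) (bound := fun ξ => ‖F ξ‖)
    (fun p => (hF.mul_schroPhase p.1 p.2).1) h2 hF.norm (Eventually.of_forall h)

lemma freeEvol_time_add (F : EuclideanSpace ℝ (Fin n) → ℂ) (t τ : ℝ)
    (x : EuclideanSpace ℝ (Fin n)) :
    freeEvol n F (t + τ) x = freeEvol n (fun ξ => F ξ * schroPhase n t 0 ξ) τ x := by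
  refine integral_congr_ae (Eventually.of_forall fun ξ => ?_)
  have := schroPhase_add t τ 0 x ξ
  simp only [zero_add] at this
  simp only [this]; ring

lemma freeEvol_space_add (F : EuclideanSpace ℝ (Fin n) → ℂ) (t : ℝ)
    (x y : EuclideanSpace ℝ (Fin n)) :
    freeEvol n F t (x + y) = freeEvol n (fun ξ => F ξ * schroPhase n 0 x ξ) t y := by
  refine integral_congr_ae (Eventually.of_forall fun ξ => ?_)
  have := schroPhase_add 0 t x y ξ
  simp only [zero_add] at this
  simp only [this]; ring

lemma norm_freeEvol_sub_le (hF : Integrable F) (hF' : Integrable fun ξ => ‖ξ‖ * ‖F ξ‖) (t : ℝ)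
    (x y : EuclideanSpace ℝ (Fin n)) :
    ‖freeEvol n F t x - freeEvol n F t y‖ ≤ ‖x - y‖ * ∫ ξ, ‖ξ‖ * ‖F ξ‖ := by
  rw [freeEvol, freeEvol, ← integral_sub (hF.mul_schroPhase t x) (hF.mul_schroPhase t y),
    ← integral_const_mul]
  refine norm_integral_le_of_norm_le (hF'.const_mul _) (Eventually.of_forall fun ξ => ?_)
  rw [← mul_sub, norm_mul]
  nlinarith [norm_schroPhase_sub_le t x y ξ, norm_nonneg (F ξ)]

end freeEvol

/-- Every Schwartz function is the Fourier transform of a Schwartz function. -/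
lemma exists_schwartz_hatFn_eq (n : ℕ) (G : SchwartzMap (EuclideanSpace ℝ (Fin n)) ℂ) :
    ∃ u : SchwartzMap (EuclideanSpace ℝ (Fin n)) ℂ, hatFn n u = G := by
  have hpi : (2 * Real.pi) ≠ 0 := by positivity
  let L : EuclideanSpace ℝ (Fin n) ≃L[ℝ] EuclideanSpace ℝ (Fin n) :=
    ContinuousLinearEquiv.smulLeft (Units.mk0 (2 * Real.pi) hpi)
  let c : ℂ := (((2 * Real.pi) ^ (-(n : ℝ) / 2) : ℝ) : ℂ)
  have hc : c ≠ 0 := by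
    simp only [c, ne_eq, Complex.ofReal_eq_zero]; positivity
  let H : SchwartzMap (EuclideanSpace ℝ (Fin n)) ℂ :=
    c⁻¹ • SchwartzMap.compCLMOfContinuousLinearEquiv ℂ L G
  refine ⟨FourierTransform.fourierInv H, ?_⟩
  ext ξ
  have h1 : FourierTransform.fourier (FourierTransform.fourierInv H)
      ((2 * Real.pi)⁻¹ • ξ) = H ((2 * Real.pi)⁻¹ • ξ) := by
    rw [FourierTransform.fourier_fourierInv_eq]
  have h2 : H ((2 * Real.pi)⁻¹ • ξ) = c⁻¹ * G ξ := by
    have : L ((2 * Real.pi)⁻¹ • ξ) = ξ := by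
      change (2 * Real.pi) • ((2 * Real.pi)⁻¹ • ξ) = ξ
      rw [smul_inv_smul₀ hpi]
    change c⁻¹ • G (L ((2 * Real.pi)⁻¹ • ξ)) = c⁻¹ * G ξ
    rw [this, smul_eq_mul]
  rw [h2, SchwartzMap.fourier_coe, Real.fourier_eq'] at h1
  have h3 : hatFn n (FourierTransform.fourierInv H) ξ = c * (c⁻¹ * G ξ) := by
    rw [← h1, hatFn]
    congr 2
    ext v
    rw [smul_eq_mul, inner_smul_right]
    congr 2
    have : (Real.pi : ℂ) ≠ 0 := by exact_mod_cast Real.pi_ne_zero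
    push_cast
    field_simp
  rw [h3, mul_inv_cancel_left₀ hc]

/-- The weight `(1 + |ξ|²)^a`. -/
noncomputable def japaneseWeight (n : ℕ) (a : ℝ) (ξ : EuclideanSpace ℝ (Fin n)) : ℝ :=
  (1 + ‖ξ‖ ^ 2) ^ a

section weight

variable {n : ℕ}

lemma japaneseWeight_pos (a : ℝ) (ξ : EuclideanSpace ℝ (Fin n)) : 0 < japaneseWeight n a ξ := by
  unfold japaneseWeight; positivity

lemma japaneseWeight_add (a b : ℝ) (ξ : EuclideanSpace ℝ (Fin n)) :
    japaneseWeight n (a + b) ξ = japaneseWeight n a ξ * japaneseWeight n b ξ :=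
  Real.rpow_add (by positivity) _ _

lemma one_le_japaneseWeight {a : ℝ} (ha : 0 ≤ a) (ξ : EuclideanSpace ℝ (Fin n)) :
    1 ≤ japaneseWeight n a ξ :=
  Real.one_le_rpow (by nlinarith [sq_nonneg ‖ξ‖]) ha

lemma contDiff_japaneseWeight (a : ℝ) {k : WithTop ℕ∞} : ContDiff ℝ k (japaneseWeight n a) := by
  unfold japaneseWeight
  refine ContDiff.rpow_const_of_ne (contDiff_const.add (contDiff_norm_sq ℝ)) fun ξ => ?_
  positivity

lemma memLp_two_japaneseWeight_neg {a : ℝ} (ha : (n : ℝ) < 4 * a) :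
    MemLp (japaneseWeight n (-a)) 2 := by
  rw [memLp_two_iff_integrable_sq (contDiff_japaneseWeight (-a) (k := 0)).continuous.aestronglyMeasurable]
  have := integrable_rpow_neg_one_add_norm_sq (E := EuclideanSpace ℝ (Fin n))
    (μ := volume) (r := 4 * a) (by simpa using ha)
  refine this.congr (Eventually.of_forall fun ξ => ?_)
  simp only [japaneseWeight]
  rw [sq (_ ^ (-a)), ← Real.rpow_add (by positivity)]
  congr 1; ring

lemma norm_sq_japaneseWeight_smul (s : ℝ) (F : EuclideanSpace ℝ (Fin n) → ℂ)
    (ξ : EuclideanSpace ℝ (Fin n)) :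
    ‖japaneseWeight n (s / 2) ξ • F ξ‖ ^ 2 = (1 + ‖ξ‖ ^ 2) ^ s * ‖F ξ‖ ^ 2 := by
  rw [norm_smul, Real.norm_of_nonneg (japaneseWeight_pos _ _).le, mul_pow, sq (japaneseWeight _ _ _),
    ← japaneseWeight_add, add_halves, japaneseWeight]

lemma memLp_two_japaneseWeight_smul {s : ℝ} {F : EuclideanSpace ℝ (Fin n) → ℂ}
    (hF : AEStronglyMeasurable F)
    (hFs : Integrable fun ξ => (1 + ‖ξ‖ ^ 2) ^ s * ‖F ξ‖ ^ 2) :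
    MemLp (fun ξ => japaneseWeight n (s / 2) ξ • F ξ) 2 := by
  rw [memLp_two_iff_integrable_sq_norm]
  · simpa only [norm_sq_japaneseWeight_smul] using hFs
  · exact (contDiff_japaneseWeight (s / 2) (k := 0)).continuous.aestronglyMeasurable.smul hF

lemma hsNormOfHat_eq {s : ℝ} {F : EuclideanSpace ℝ (Fin n) → ℂ}
    (hF : MemLp (fun ξ => japaneseWeight n (s / 2) ξ • F ξ) 2) :
    hsNormOfHat n s F = (eLpNorm (fun ξ => japaneseWeight n (s / 2) ξ • F ξ) 2 volume).toReal := by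
  rw [hF.eLpNorm_eq_integral_rpow_norm (by simp) (by simp), ENNReal.toReal_ofReal (by positivity),
    hsNormOfHat]
  have : ∀ ξ, ‖japaneseWeight n (s / 2) ξ • F ξ‖ ^ (2 : ℝ≥0∞).toReal
      = (1 + ‖ξ‖ ^ 2) ^ s * ‖F ξ‖ ^ 2 := by
    intro ξ
    rw [← norm_sq_japaneseWeight_smul]; simp
  simp only [this]
  norm_num

/-- Density of Schwartz functions in `L²`. -/
lemma exists_schwartz_eLpNorm_sub_le {A : EuclideanSpace ℝ (Fin n) → ℂ} (hA : MemLp A 2)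
    {δ : ℝ} (hδ : 0 < δ) :
    ∃ g : SchwartzMap (EuclideanSpace ℝ (Fin n)) ℂ, eLpNorm (A - ⇑g) 2 volume ≤ ENNReal.ofReal δ := by
  obtain ⟨g, hg1, hg2, hg3⟩ := hA.exist_eLpNorm_sub_le (by simp) (by norm_num) hδ
  exact ⟨hg1.toSchwartzMap hg2, hg3⟩

/-- Multiplication of a Schwartz function by a power of the weight. -/
lemma exists_schwartz_japaneseWeight_smul (a : ℝ)
    (g : SchwartzMap (EuclideanSpace ℝ (Fin n)) ℂ) :
    ∃ G : SchwartzMap (EuclideanSpace ℝ (Fin n)) ℂ,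
      ∀ ξ, G ξ = japaneseWeight n a ξ • g ξ :=
  ⟨SchwartzMap.smulLeftCLM ℂ (japaneseWeight n a) g, fun ξ =>
    SchwartzMap.smulLeftCLM_apply_apply
      (Function.hasTemperateGrowth_one_add_norm_sq_rpow (EuclideanSpace ℝ (Fin n)) a) g ξ⟩

lemma hsNormOfHat_nonneg (s : ℝ) (F : EuclideanSpace ℝ (Fin n) → ℂ) : 0 ≤ hsNormOfHat n s F :=
  Real.rpow_nonneg (integral_nonneg fun _ => by positivity) _

lemma hsNormOfHat_sq (s : ℝ) (F : EuclideanSpace ℝ (Fin n) → ℂ) :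
    hsNormOfHat n s F ^ 2 = ∫ ξ, (1 + ‖ξ‖ ^ 2) ^ s * ‖F ξ‖ ^ 2 := by
  rw [hsNormOfHat, ← Real.rpow_natCast, ← Real.rpow_mul (integral_nonneg fun _ => by positivity)]
  norm_num

/-- Data with compact frequency support are approximated by Schwartz functions in `H^s`, and their
Fourier transforms simultaneously in `L¹`. -/
lemma exists_schwartz_approx {s : ℝ} (hs : 0 ≤ s) {F : EuclideanSpace ℝ (Fin n) → ℂ}
    (hF : AEStronglyMeasurable F) {R : ℝ} (hR : ∀ ξ, R < ‖ξ‖ → F ξ = 0)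
    (hFs : Integrable fun ξ => (1 + ‖ξ‖ ^ 2) ^ s * ‖F ξ‖ ^ 2) {ε : ℝ} (hε : 0 < ε) :
    ∃ G : SchwartzMap (EuclideanSpace ℝ (Fin n)) ℂ, Integrable F ∧ ∫ ξ, ‖F ξ - G ξ‖ ≤ ε ∧
      hsNormOfHat n s G ≤ hsNormOfHat n s F + ε := by
  set a : ℝ := s / 2 + (n + 1) with ha
  have hFs2 := memLp_two_japaneseWeight_smul hF hFs
  have hw := memLp_two_japaneseWeight_neg (n := n) (a := a) (by rw [ha]; linarith [n.cast_nonneg (α := ℝ)])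
  have hcw : ∀ b, Continuous (japaneseWeight n b) := fun b => (contDiff_japaneseWeight b (k := 0)).continuous
  have hA : MemLp (fun ξ => japaneseWeight n a ξ • F ξ) 2 := by
    refine hFs2.of_le_mul (c := (1 + R ^ 2) ^ ((n : ℝ) + 1))
      ((hcw a).aestronglyMeasurable.smul hF) (Eventually.of_forall fun ξ => ?_)
    rcases lt_or_ge R ‖ξ‖ with h | h
    · simp [hR ξ h]
    · rw [ha, add_comm, japaneseWeight_add, mul_smul, norm_smul,
        Real.norm_of_nonneg (japaneseWeight_pos _ _).le]
      gcongr
      unfold japaneseWeight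
      gcongr
  set K := (eLpNorm (japaneseWeight n (-a)) 2 volume).toReal
  have hK : 0 ≤ K := ENNReal.toReal_nonneg
  set δ := min ε (ε / (K + 1))
  have hδ : 0 < δ := by positivity
  obtain ⟨g, hg3⟩ := exists_schwartz_eLpNorm_sub_le hA hδ
  have hwinv : ∀ ξ, japaneseWeight n (-a) ξ * japaneseWeight n a ξ = 1 := by
    intro ξ; rw [← japaneseWeight_add]; simp [japaneseWeight]
  obtain ⟨G, hG⟩ := exists_schwartz_japaneseWeight_smul (-a) g
  have hgL : MemLp g 2 := g.memLp 2
  set D := (fun ξ => japaneseWeight n a ξ • F ξ) - g with hD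
  have hDL : MemLp D 2 := hA.sub hgL
  have hFG : ∀ ξ, F ξ - G ξ = japaneseWeight n (-a) ξ • D ξ := by
    intro ξ
    rw [hD, Pi.sub_apply, smul_sub, smul_smul, hwinv, one_smul, hG]
  have hFGI : Integrable fun ξ => F ξ - G ξ := by
    simp only [hFG]
    exact memLp_one_iff_integrable.1 (hDL.smul hw)
  have hGI : Integrable G := G.integrable
  refine ⟨G, ?_, ?_, ?_⟩
  · exact (hFGI.add hGI).congr (Eventually.of_forall fun ξ => by simp)
  · have h1 : eLpNorm (japaneseWeight n (-a) • D) 1 volume ≤ ENNReal.ofReal ε := by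
      refine (eLpNorm_smul_le_mul_eLpNorm (p := 2) (q := 2) hDL.1 hw.1).trans ?_
      rw [← ENNReal.ofReal_toReal hw.eLpNorm_ne_top]
      refine (mul_le_mul_right hg3 _).trans ?_
      rw [← ENNReal.ofReal_mul ENNReal.toReal_nonneg]
      refine ENNReal.ofReal_le_ofReal ?_
      have : δ ≤ ε / (K + 1) := min_le_right _ _
      calc K * δ ≤ (K + 1) * (ε / (K + 1)) := by gcongr; linarith
        _ = ε := by field_simp
    rw [integral_norm_eq_lintegral_enorm hFGI.1]
    refine ENNReal.toReal_le_of_le_ofReal hε.le ?_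
    rw [← eLpNorm_one_eq_lintegral_enorm]
    refine (le_of_eq (congrArg (eLpNorm · 1 volume) ?_)).trans h1
    ext ξ; simp [hFG]
  · have hb : ∀ ξ, ‖japaneseWeight n (s / 2) ξ • (G ξ - F ξ)‖ ≤ ‖D ξ‖ := by
      intro ξ
      rw [← neg_sub, smul_neg, norm_neg, hFG, smul_smul, ← japaneseWeight_add, norm_smul,
        Real.norm_of_nonneg (japaneseWeight_pos _ _).le]
      refine mul_le_of_le_one_left (norm_nonneg _) ?_
      refine Real.rpow_le_one_of_one_le_of_nonpos (by nlinarith [sq_nonneg ‖ξ‖]) ?_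
      rw [ha]; linarith [n.cast_nonneg (α := ℝ)]
    have hdiff : MemLp (fun ξ => japaneseWeight n (s / 2) ξ • (G ξ - F ξ)) 2 :=
      hDL.of_le ((hcw _).aestronglyMeasurable.smul (hGI.1.sub hF)) (Eventually.of_forall hb)
    have hsum : (fun ξ => japaneseWeight n (s / 2) ξ • G ξ) =
        (fun ξ => japaneseWeight n (s / 2) ξ • F ξ) +
          fun ξ => japaneseWeight n (s / 2) ξ • (G ξ - F ξ) := by
      ext ξ; simp [smul_sub]
    have hGs : MemLp (fun ξ => japaneseWeight n (s / 2) ξ • G ξ) 2 := by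
      rw [hsum]; exact hFs2.add hdiff
    rw [hsNormOfHat_eq hGs, hsNormOfHat_eq hFs2]
    refine ENNReal.toReal_le_of_le_ofReal (by positivity) ?_
    rw [ENNReal.ofReal_add ENNReal.toReal_nonneg hε.le, ENNReal.ofReal_toReal hFs2.eLpNorm_ne_top,
      hsum]
    refine (eLpNorm_add_le hFs2.1 hdiff.1 (by norm_num)).trans ?_
    gcongr
    refine (eLpNorm_mono hb).trans (hg3.trans (ENNReal.ofReal_le_ofReal (min_le_left _ _)))

end weight

/-- The maximal estimate over unit time with constant `C`, for Schwartz data and `α`-dimensional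
measures. -/
def SchwartzMaximalBound (n : ℕ) (s α C : ℝ) : Prop :=
  ∀ u₀ : SchwartzMap (EuclideanSpace ℝ (Fin n)) ℂ,
  ∀ μ : Measure (EuclideanSpace ℝ (Fin n)), IsAlphaDimensional n α μ →
    ∫⁻ x, (⨆ (t : ℝ) (_ : t ∈ Ioo (0 : ℝ) 1),
        ENNReal.ofReal ‖schroEvol n u₀ t x‖) ∂μ
      ≤ ENNReal.ofReal (C * Real.sqrt ((cAlpha n α μ).toReal * (μ univ).toReal) *
          hsNormOfHat n s (hatFn n (⇑u₀)))

section maximal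

variable {n : ℕ} {s α C : ℝ} {F : EuclideanSpace ℝ (Fin n) → ℂ}
  {μ : Measure (EuclideanSpace ℝ (Fin n))}

lemma measure_ball_le_cAlpha (x : EuclideanSpace ℝ (Fin n)) {r : ℝ} (hr : 0 < r) :
    μ (ball x r) ≤ cAlpha n α μ * ENNReal.ofReal (r ^ α) := by
  have h : μ (ball x r) / ENNReal.ofReal (r ^ α) ≤ cAlpha n α μ :=
    le_iSup₂_of_le x r (le_iSup_of_le hr le_rfl)
  rwa [ENNReal.div_le_iff (by simpa using Real.rpow_pos_of_pos hr α) ENNReal.ofReal_ne_top] at h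

lemma IsAlphaDimensional.measure_univ_ne_top (h : IsAlphaDimensional n α μ) : μ univ ≠ ⊤ := by
  have h1 : (univ : Set (EuclideanSpace ℝ (Fin n))) ⊆ ball 0 2 ∪ (closedBall 0 1)ᶜ := by
    intro x _
    by_cases hx : x ∈ closedBall (0 : EuclideanSpace ℝ (Fin n)) 1
    · exact Or.inl (closedBall_subset_ball (by norm_num) hx)
    · exact Or.inr hx
  refine ((measure_mono h1).trans (measure_union_le _ _)).trans_lt ?_ |>.ne
  rw [h.1, add_zero]
  exact (measure_ball_le_cAlpha 0 two_pos).trans_lt (ENNReal.mul_lt_top h.2.lt_top ENNReal.ofReal_lt_top)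

lemma schroEvol_eq_freeEvol (u : SchwartzMap (EuclideanSpace ℝ (Fin n)) ℂ) (t : ℝ)
    (x : EuclideanSpace ℝ (Fin n)) :
    schroEvol n u t x =
      (((2 * Real.pi) ^ (-(n : ℝ) / 2) : ℝ) : ℂ) * freeEvol n (hatFn n u) t x := rfl

/-- The maximal estimate extends from Schwartz data to data of compact frequency support. -/
lemma SchwartzMaximalBound.lintegral_iSup_freeEvol_le (h : SchwartzMaximalBound n s α C)
    (hs : 0 ≤ s) (hF : AEStronglyMeasurable F) {R : ℝ} (hR : ∀ ξ, R < ‖ξ‖ → F ξ = 0)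
    (hFs : Integrable fun ξ => (1 + ‖ξ‖ ^ 2) ^ s * ‖F ξ‖ ^ 2) (hC : 0 ≤ C)
    (hμ : IsAlphaDimensional n α μ) :
    ∫⁻ x, (⨆ (t : ℝ) (_ : t ∈ Ioo (0 : ℝ) 1), ENNReal.ofReal ‖freeEvol n F t x‖) ∂μ
      ≤ ENNReal.ofReal ((2 * Real.pi) ^ ((n : ℝ) / 2) * C *
          Real.sqrt ((cAlpha n α μ).toReal * (μ univ).toReal) * hsNormOfHat n s F) := by
  set c : ℝ := (2 * Real.pi) ^ ((n : ℝ) / 2) with hc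
  have hc0 : 0 < c := by positivity
  set q := Real.sqrt ((cAlpha n α μ).toReal * (μ univ).toReal)
  have hq : 0 ≤ q := Real.sqrt_nonneg _
  set m := (μ univ).toReal
  have hm : 0 ≤ m := ENNReal.toReal_nonneg
  have hN := hsNormOfHat_nonneg (n := n) s F
  have key : ∀ ε : ℝ, 0 < ε →
      ∫⁻ x, (⨆ (t : ℝ) (_ : t ∈ Ioo (0 : ℝ) 1), ENNReal.ofReal ‖freeEvol n F t x‖) ∂μ
      ≤ ENNReal.ofReal (c * (C * q * (hsNormOfHat n s F + ε)) + ε * m) := by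
    intro ε hε
    obtain ⟨G, hFI, hFG, hGs⟩ := exists_schwartz_approx hs hF hR hFs hε
    obtain ⟨u, hu⟩ := exists_schwartz_hatFn_eq n G
    have hpt : ∀ x, (⨆ (t : ℝ) (_ : t ∈ Ioo (0 : ℝ) 1), ENNReal.ofReal ‖freeEvol n F t x‖) ≤
        ENNReal.ofReal c * (⨆ (t : ℝ) (_ : t ∈ Ioo (0 : ℝ) 1),
          ENNReal.ofReal ‖schroEvol n u t x‖) + ENNReal.ofReal ε := by
      intro x
      refine iSup₂_le fun t ht => ?_
      have h1 : ‖freeEvol n F t x‖ ≤ c * ‖schroEvol n u t x‖ + ε := by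
        have h2 : ‖freeEvol n F t x - freeEvol n G t x‖ ≤ ε := by
          rw [← freeEvol_sub hFI G.integrable]
          exact (norm_freeEvol_le _ t x).trans hFG
        have h3 : c * ‖schroEvol n u t x‖ = ‖freeEvol n G t x‖ := by
          rw [schroEvol_eq_freeEvol, hu, norm_mul, Complex.norm_real, Real.norm_of_nonneg
            (by positivity), ← mul_assoc, hc, ← Real.rpow_add (by positivity)]
          ring_nf; simp
        rw [h3]
        linarith [norm_sub_norm_le (freeEvol n F t x) (freeEvol n G t x)]
      calc ENNReal.ofReal ‖freeEvol n F t x‖ ≤ ENNReal.ofReal (c * ‖schroEvol n u t x‖ + ε) :=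
            ENNReal.ofReal_le_ofReal h1
        _ = ENNReal.ofReal c * ENNReal.ofReal ‖schroEvol n u t x‖ + ENNReal.ofReal ε := by
            rw [ENNReal.ofReal_add (by positivity) hε.le, ENNReal.ofReal_mul hc0.le]
        _ ≤ _ := by
            gcongr
            exact le_iSup₂_of_le t ht le_rfl
    refine (lintegral_mono hpt).trans ?_
    rw [lintegral_add_right _ measurable_const, lintegral_const_mul' _ _ ENNReal.ofReal_ne_top,
      lintegral_const, ENNReal.ofReal_add (by positivity) (by positivity),
      ENNReal.ofReal_mul hc0.le, ENNReal.ofReal_mul hε.le,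
      ENNReal.ofReal_toReal hμ.measure_univ_ne_top]
    gcongr
    refine (h u μ hμ).trans (ENNReal.ofReal_le_ofReal ?_)
    rw [hu]
    gcongr
  have hcont : Continuous fun ε : ℝ =>
      ENNReal.ofReal (c * (C * q * (hsNormOfHat n s F + ε)) + ε * m) :=
    ENNReal.continuous_ofReal.comp (by fun_prop)
  have hlim := (hcont.tendsto 0).mono_left (nhdsWithin_le_nhds (s := Ioi 0))
  refine (ge_of_tendsto hlim ?_).trans_eq ?_
  · filter_upwards [self_mem_nhdsWithin] with ε hε using key ε hε
  · congr 1; ring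

/-- The time-weighted global maximal function `sup_τ (1 + |τ|)^{-3/2} |e^{iτΔ}u|`. -/
noncomputable def weightedMaximal (n : ℕ) (F : EuclideanSpace ℝ (Fin n) → ℂ)
    (x : EuclideanSpace ℝ (Fin n)) : ℝ :=
  ⨆ τ : ℝ, (1 + |τ|) ^ (-(3 / 2) : ℝ) * ‖freeEvol n F τ x‖

lemma weightedMaximal_bddAbove (F : EuclideanSpace ℝ (Fin n) → ℂ)
    (x : EuclideanSpace ℝ (Fin n)) :
    BddAbove (range fun τ : ℝ => (1 + |τ|) ^ (-(3 / 2) : ℝ) * ‖freeEvol n F τ x‖) := by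
  refine ⟨∫ ξ, ‖F ξ‖, ?_⟩
  rintro _ ⟨τ, rfl⟩
  refine (mul_le_of_le_one_left (norm_nonneg _) ?_).trans (norm_freeEvol_le F τ x)
  exact Real.rpow_le_one_of_one_le_of_nonpos (by linarith [abs_nonneg τ]) (by norm_num)

lemma norm_freeEvol_le_weightedMaximal (F : EuclideanSpace ℝ (Fin n) → ℂ) (τ : ℝ)
    (x : EuclideanSpace ℝ (Fin n)) :
    ‖freeEvol n F τ x‖ ≤ (1 + |τ|) ^ (3 / 2 : ℝ) * weightedMaximal n F x := by
  have h := le_ciSup (weightedMaximal_bddAbove F x) τ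
  have h1 : (0 : ℝ) < 1 + |τ| := by positivity
  have h2 := mul_le_mul_of_nonneg_left h (by positivity : 0 ≤ (1 + |τ|) ^ (3 / 2 : ℝ))
  rw [← mul_assoc, ← Real.rpow_add h1] at h2
  simpa [weightedMaximal] using h2

lemma weightedMaximal_nonneg (F : EuclideanSpace ℝ (Fin n) → ℂ)
    (x : EuclideanSpace ℝ (Fin n)) : 0 ≤ weightedMaximal n F x :=
  Real.iSup_nonneg fun _ => by positivity

lemma weightedMaximal_le_add (hF : Integrable F) (hF' : Integrable fun ξ => ‖ξ‖ * ‖F ξ‖)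
    (x y : EuclideanSpace ℝ (Fin n)) :
    weightedMaximal n F x ≤ weightedMaximal n F y + ‖x - y‖ * ∫ ξ, ‖ξ‖ * ‖F ξ‖ := by
  refine ciSup_le fun τ => ?_
  have h := norm_freeEvol_sub_le hF hF' τ x y
  have h0 := norm_sub_norm_le (freeEvol n F τ x) (freeEvol n F τ y)
  have h1 := le_ciSup (weightedMaximal_bddAbove F y) τ
  have h2 : (1 + |τ|) ^ (-(3 / 2) : ℝ) ≤ 1 :=
    Real.rpow_le_one_of_one_le_of_nonpos (by linarith [abs_nonneg τ]) (by norm_num)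
  have h3 : 0 ≤ (1 + |τ|) ^ (-(3 / 2) : ℝ) := by positivity
  have h4 : (1 + |τ|) ^ (-(3 / 2) : ℝ) * ‖freeEvol n F τ x‖ ≤
      (1 + |τ|) ^ (-(3 / 2) : ℝ) * ‖freeEvol n F τ y‖ + ‖x - y‖ * ∫ ξ, ‖ξ‖ * ‖F ξ‖ := by
    nlinarith [norm_nonneg (freeEvol n F τ x - freeEvol n F τ y)]
  refine h4.trans (add_le_add_left ?_ _)
  exact h1

lemma summable_one_add_abs_int_rpow :
    Summable fun k : ℤ => (1 + |(k : ℝ)|) ^ (-(3 / 2) : ℝ) := by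
  have h := (Real.summable_nat_rpow (p := -(3 / 2))).2 (by norm_num)
  have h1 := (summable_nat_add_iff 1).2 h
  refine Summable.of_nat_of_neg ?_ ?_ <;>
  · refine h1.congr fun k => ?_
    simp [add_comm]

/-- The constant in the estimate of the weighted maximal function. -/
noncomputable def weightSum : ℝ :=
  ∑' k : ℤ, 2 ^ (3 / 2 : ℝ) * (1 + |(k : ℝ)|) ^ (-(3 / 2) : ℝ)

lemma weightSum_nonneg : 0 ≤ weightSum := tsum_nonneg fun _ => by positivity

lemma norm_freeEvol_le_iSup (hF : Integrable F) (x : EuclideanSpace ℝ (Fin n)) {t : ℝ}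
    (ht : t ∈ Icc (0 : ℝ) 1) :
    ENNReal.ofReal ‖freeEvol n F t x‖ ≤
      ⨆ (t : ℝ) (_ : t ∈ Ioo (0 : ℝ) 1), ENNReal.ofReal ‖freeEvol n F t x‖ := by
  have hc : Continuous fun t => ENNReal.ofReal ‖freeEvol n F t x‖ :=
    ENNReal.continuous_ofReal.comp
      ((continuous_freeEvol hF).comp (by fun_prop : Continuous fun t : ℝ => (t, x))).norm
  set S := ⨆ (t : ℝ) (_ : t ∈ Ioo (0 : ℝ) 1), ENNReal.ofReal ‖freeEvol n F t x‖ with hS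
  have hcl : IsClosed {t | ENNReal.ofReal ‖freeEvol n F t x‖ ≤ S} :=
    isClosed_le hc continuous_const
  have hsub : Ioo (0 : ℝ) 1 ⊆ {t | ENNReal.ofReal ‖freeEvol n F t x‖ ≤ S} := fun t ht =>
    le_iSup₂_of_le (f := fun (t : ℝ) (_ : t ∈ Ioo (0 : ℝ) 1) =>
      ENNReal.ofReal ‖freeEvol n F t x‖) t ht le_rfl
  rw [← closure_Ioo zero_ne_one] at ht
  exact closure_minimal hsub hcl ht

lemma one_add_abs_rpow_le (τ : ℝ) :
    (1 + |τ|) ^ (-(3 / 2) : ℝ) ≤ 2 ^ (3 / 2 : ℝ) * (1 + |((⌊τ⌋ : ℤ) : ℝ)|) ^ (-(3 / 2) : ℝ) := by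
  have h : (1 + |((⌊τ⌋ : ℤ) : ℝ)|) / 2 ≤ 1 + |τ| := by
    have h1 := Int.fract_nonneg τ
    have h2 := (Int.fract_lt_one τ).le
    have h3 := Int.floor_add_fract τ
    have h4 : |((⌊τ⌋ : ℤ) : ℝ)| ≤ |τ| + 1 := by
      have : ((⌊τ⌋ : ℤ) : ℝ) = τ - Int.fract τ := by linarith
      rw [this]
      exact (abs_sub _ _).trans (by rw [abs_of_nonneg h1]; linarith)
    linarith [abs_nonneg τ]
  have h5 : (0 : ℝ) < 1 + |((⌊τ⌋ : ℤ) : ℝ)| := by positivity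
  refine (Real.rpow_le_rpow_of_nonpos (by positivity) h (by norm_num)).trans_eq ?_
  rw [Real.div_rpow h5.le (by norm_num), Real.rpow_neg (by norm_num : (0 : ℝ) ≤ 2), div_inv_eq_mul,
    mul_comm]

lemma ofReal_weightedMaximal_le (hF : Integrable F) (x : EuclideanSpace ℝ (Fin n)) :
    ENNReal.ofReal (weightedMaximal n F x) ≤
      ∑' k : ℤ, ENNReal.ofReal (2 ^ (3 / 2 : ℝ) * (1 + |(k : ℝ)|) ^ (-(3 / 2) : ℝ)) *
        ⨆ (t : ℝ) (_ : t ∈ Ioo (0 : ℝ) 1),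
          ENNReal.ofReal ‖freeEvol n (fun ξ => F ξ * schroPhase n k 0 ξ) t x‖ := by
  set S := ∑' k : ℤ, ENNReal.ofReal (2 ^ (3 / 2 : ℝ) * (1 + |(k : ℝ)|) ^ (-(3 / 2) : ℝ)) *
        ⨆ (t : ℝ) (_ : t ∈ Ioo (0 : ℝ) 1),
          ENNReal.ofReal ‖freeEvol n (fun ξ => F ξ * schroPhase n k 0 ξ) t x‖ with hSdef
  by_cases hS : S = ⊤
  · exact hS ▸ le_top
  refine ENNReal.ofReal_le_of_le_toReal
    (ciSup_le fun τ => (ENNReal.ofReal_le_iff_le_toReal hS).1 ?_)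
  refine le_trans ?_ (ENNReal.le_tsum ⌊τ⌋)
  rw [ENNReal.ofReal_mul (by positivity)]
  gcongr
  · exact one_add_abs_rpow_le τ
  · have := norm_freeEvol_le_iSup (hF.mul_schroPhase ⌊τ⌋ 0) x
      (t := Int.fract τ) ⟨Int.fract_nonneg τ, (Int.fract_lt_one τ).le⟩
    rwa [← freeEvol_time_add, Int.floor_add_fract] at this

/-- The weighted global maximal function obeys the same estimate as the local one. -/
lemma SchwartzMaximalBound.lintegral_weightedMaximal_le (h : SchwartzMaximalBound n s α C)
    (hs : 0 ≤ s) (hF : Integrable F) {R : ℝ} (hR : ∀ ξ, R < ‖ξ‖ → F ξ = 0)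
    (hFs : Integrable fun ξ => (1 + ‖ξ‖ ^ 2) ^ s * ‖F ξ‖ ^ 2) (hC : 0 ≤ C)
    (hμ : IsAlphaDimensional n α μ) :
    ∫⁻ x, ENNReal.ofReal (weightedMaximal n F x) ∂μ
      ≤ ENNReal.ofReal (weightSum * ((2 * Real.pi) ^ ((n : ℝ) / 2) * C *
          Real.sqrt ((cAlpha n α μ).toReal * (μ univ).toReal) * hsNormOfHat n s F)) := by
  refine (lintegral_mono (ofReal_weightedMaximal_le hF)).trans ?_
  have hmeas : ∀ k : ℤ, Measurable fun x => ⨆ (t : ℝ) (_ : t ∈ Ioo (0 : ℝ) 1),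
      ENNReal.ofReal ‖freeEvol n (fun ξ => F ξ * schroPhase n k 0 ξ) t x‖ := by
    intro k
    refine (lowerSemicontinuous_iSup fun t => lowerSemicontinuous_iSup fun _ => ?_).measurable
    refine Continuous.lowerSemicontinuous (ENNReal.continuous_ofReal.comp ?_)
    exact ((continuous_freeEvol (hF.mul_schroPhase k 0)).comp
      (by fun_prop : Continuous fun x => (t, x))).norm
  rw [lintegral_tsum fun k => ((hmeas k).const_mul _).aemeasurable]
  set q := Real.sqrt ((cAlpha n α μ).toReal * (μ univ).toReal)
  have hN := hsNormOfHat_nonneg (n := n) s F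
  rw [weightSum, ← tsum_mul_right, ENNReal.ofReal_tsum_of_nonneg (fun _ => by positivity)
    ((summable_one_add_abs_int_rpow.mul_left _).mul_right _)]
  refine ENNReal.tsum_le_tsum fun k => ?_
  rw [lintegral_const_mul _ (hmeas k), ENNReal.ofReal_mul (q := _ * hsNormOfHat n s F) (by positivity)]
  refine mul_le_mul' le_rfl ?_
  have hn : hsNormOfHat n s (fun ξ => F ξ * schroPhase n k 0 ξ) = hsNormOfHat n s F := by
    simp [hsNormOfHat]
  rw [← hn]
  refine h.lintegral_iSup_freeEvol_le hs (hF.mul_schroPhase k 0).1 (R := R) ?_ ?_ hC hμ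
  · intro ξ hξ; simp [hR ξ hξ]
  · simpa using hFs

end maximal

section dyadic

variable {n : ℕ}

/-- The index of the half-open dyadic cell of side `1 / (n * 2 ^ j)` that contains `x`. -/
noncomputable def dyadicIndex (n j : ℕ) (x : EuclideanSpace ℝ (Fin n)) : Fin n → ℤ :=
  fun i => ⌊(2 : ℝ) ^ j * (n * x i)⌋

/-- The half-open dyadic cell of side `1 / (n * 2 ^ j)` with index `k`. -/
def dyadicCell (n j : ℕ) (k : Fin n → ℤ) : Set (EuclideanSpace ℝ (Fin n)) :=
  {x | dyadicIndex n j x = k}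

/-- The side length of the dyadic cells of generation `j`. -/
noncomputable def dyadicSide (n j : ℕ) : ℝ := ((2 : ℝ) ^ j * n)⁻¹

lemma dyadicSide_pos (hn : 1 ≤ n) (j : ℕ) : 0 < dyadicSide n j := by
  have : (0 : ℝ) < n := by exact_mod_cast hn
  unfold dyadicSide; positivity

lemma measurable_dyadicIndex (j : ℕ) : Measurable (dyadicIndex n j) := by
  refine measurable_pi_lambda _ fun i => Int.measurable_floor.comp ?_
  fun_prop

lemma measurableSet_dyadicCell (j : ℕ) (k : Fin n → ℤ) : MeasurableSet (dyadicCell n j k) :=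
  measurable_dyadicIndex j (measurableSet_singleton k)

lemma dyadicIndex_eq_div_two (j : ℕ) (x : EuclideanSpace ℝ (Fin n)) :
    dyadicIndex n j x = fun i => dyadicIndex n (j + 1) x i / 2 := by
  funext i
  have h := Int.floor_div_natCast ((2 : ℝ) ^ (j + 1) * (n * x i)) 2
  simp only [dyadicIndex]
  rw [show (2 : ℝ) ^ j * (n * x i) = (2 : ℝ) ^ (j + 1) * (n * x i) / ((2 : ℕ) : ℝ) by
    push_cast; ring, h]
  rfl

lemma dyadicCell_eq_iUnion (j : ℕ) (k : Fin n → ℤ) :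
    dyadicCell n j k =
      ⋃ k' : {k' : Fin n → ℤ // (fun i => k' i / 2) = k}, dyadicCell n (j + 1) k' := by
  ext x
  simp only [dyadicCell, mem_ofPred_eq, mem_iUnion, Subtype.exists, exists_prop]
  rw [dyadicIndex_eq_div_two]
  exact ⟨fun h => ⟨_, h, rfl⟩, by rintro ⟨k', h, rfl⟩; exact h⟩

lemma pairwise_disjoint_dyadicCell (j : ℕ) : Pairwise (Function.onFun Disjoint (dyadicCell n j)) := by
  intro k k' h
  refine Set.disjoint_left.2 fun x hx hx' => h ?_
  exact hx.symm.trans hx'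

lemma mem_dyadicCell_iff (hn : 1 ≤ n) (j : ℕ) (k : Fin n → ℤ) (x : EuclideanSpace ℝ (Fin n)) :
    x ∈ dyadicCell n j k ↔
      ∀ i, x i ∈ Ico (k i * dyadicSide n j) (k i * dyadicSide n j + dyadicSide n j) := by
  have h0 : (0 : ℝ) < 2 ^ j * n := inv_pos.1 (dyadicSide_pos hn j)
  simp only [dyadicCell, mem_ofPred_eq, funext_iff, dyadicIndex, Int.floor_eq_iff, mem_Ico,
    dyadicSide]
  refine forall_congr' fun i => ?_
  rw [← div_eq_mul_inv, ← one_div, ← add_div, div_le_iff₀ h0, lt_div_iff₀ h0, ← mul_assoc,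
    mul_comm (x i)]

lemma volume_dyadicCell (hn : 1 ≤ n) (j : ℕ) (k : Fin n → ℤ) :
    volume (dyadicCell n j k) = ENNReal.ofReal (dyadicSide n j ^ n) := by
  have h : dyadicCell n j k = (MeasurableEquiv.toLp 2 (Fin n → ℝ)).symm ⁻¹'
      (Set.pi univ fun i =>
        Ico (k i * dyadicSide n j) (k i * dyadicSide n j + dyadicSide n j)) := by
    ext x
    rw [mem_dyadicCell_iff hn]
    simp
  rw [h, (EuclideanSpace.volume_preserving_symm_measurableEquiv_toLp (Fin n)).measure_preimage
    (MeasurableSet.univ_pi fun i => measurableSet_Ico).nullMeasurableSet, Real.volume_pi_Ico]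
  simp [ENNReal.ofReal_pow (dyadicSide_pos hn j).le]

lemma volume_ball_le (x : EuclideanSpace ℝ (Fin n)) {r : ℝ} (hr : 0 < r) :
    volume (ball x r) ≤ ENNReal.ofReal ((2 * r) ^ n) := by
  have h : ball x r ⊆ (MeasurableEquiv.toLp 2 (Fin n → ℝ)).symm ⁻¹'
      (Set.pi univ fun i => Ioo (x i - r) (x i + r)) := by
    intro y hy
    simp only [mem_preimage, Set.mem_pi, mem_univ, forall_const]
    intro i
    have h1 : |y i - x i| ≤ ‖y - x‖ := by simpa using PiLp.norm_apply_le (y - x) i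
    have h2 : ‖y - x‖ < r := by simpa [dist_eq_norm] using hy
    have h3 := abs_lt.1 (h1.trans_lt h2)
    exact ⟨by simpa using by linarith [h3.1], by simpa using by linarith [h3.2]⟩
  refine (measure_mono h).trans_eq ?_
  rw [(EuclideanSpace.volume_preserving_symm_measurableEquiv_toLp (Fin n)).measure_preimage
    (MeasurableSet.univ_pi fun i => measurableSet_Ioo).nullMeasurableSet, Real.volume_pi_Ioo]
  simp [← two_mul, ENNReal.ofReal_pow (show 0 ≤ 2 * r by linarith)]

lemma dist_le_of_dyadicIndex_eq (hn : 1 ≤ n) {j : ℕ} {x y : EuclideanSpace ℝ (Fin n)}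
    (h : dyadicIndex n j x = dyadicIndex n j y) : dist x y ≤ Real.sqrt n * dyadicSide n j := by
  have hx := (mem_dyadicCell_iff hn j _ x).1 rfl
  have hy := (mem_dyadicCell_iff hn j (dyadicIndex n j x) y).1 h.symm
  rw [EuclideanSpace.dist_eq, ← Real.sqrt_sq (dyadicSide_pos hn j).le,
    ← Real.sqrt_mul (Nat.cast_nonneg n)]
  refine Real.sqrt_le_sqrt ?_
  refine (Finset.sum_le_card_nsmul _ _ (dyadicSide n j ^ 2) fun i _ => ?_).trans_eq (by simp)
  have h1 := hx i
  have h2 := hy i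
  rw [Real.dist_eq]
  have : |x i - y i| ≤ dyadicSide n j := abs_le.2 ⟨by linarith [h1.1, h2.2], by linarith [h1.2, h2.1]⟩
  gcongr

lemma ediam_dyadicCell_le (hn : 1 ≤ n) (j : ℕ) (k : Fin n → ℤ) :
    ediam (dyadicCell n j k) ≤ ENNReal.ofReal (Real.sqrt n * dyadicSide n j) := by
  refine ediam_le fun x hx y hy => ?_
  rw [edist_dist]
  exact ENNReal.ofReal_le_ofReal (dist_le_of_dyadicIndex_eq hn (hx.trans hy.symm))

lemma dyadicIndex_sub_mem (hn : 1 ≤ n) {j : ℕ} {x y : EuclideanSpace ℝ (Fin n)}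
    (h : dist y x < dyadicSide n j) (i : Fin n) :
    dyadicIndex n j y i - dyadicIndex n j x i ∈ Finset.Icc (-1 : ℤ) 1 := by
  have hx := (mem_dyadicCell_iff hn j _ x).1 rfl i
  have hy := (mem_dyadicCell_iff hn j _ y).1 rfl i
  have h0 := dyadicSide_pos hn j
  have h1 : |y i - x i| ≤ ‖y - x‖ := by simpa using PiLp.norm_apply_le (y - x) i
  rw [← dist_eq_norm] at h1
  have h3 := abs_lt.1 (h1.trans_lt h)
  set a := dyadicIndex n j x i
  set b := dyadicIndex n j y i
  have h4 : (b : ℝ) - a < 2 := by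
    by_contra hc
    nlinarith [hx.1, hx.2, hy.1, hy.2, h3.1, h3.2, mul_le_mul_of_nonneg_right (not_lt.1 hc) h0.le]
  have h5 : (a : ℝ) - b < 2 := by
    by_contra hc
    nlinarith [hx.1, hx.2, hy.1, hy.2, h3.1, h3.2, mul_le_mul_of_nonneg_right (not_lt.1 hc) h0.le]
  have h6 : b - a < 2 := by exact_mod_cast h4
  have h7 : a - b < 2 := by exact_mod_cast h5
  rw [Finset.mem_Icc]; omega

lemma dyadicCell_zero_subset (hn : 1 ≤ n) : dyadicCell n 0 0 ⊆ closedBall 0 1 := by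
  intro x hx
  have h0 : (0 : EuclideanSpace ℝ (Fin n)) ∈ dyadicCell n 0 0 := by
    funext i; simp [dyadicIndex]
  have hn' : (1 : ℝ) ≤ n := by exact_mod_cast hn
  rw [mem_closedBall]
  refine (dist_le_of_dyadicIndex_eq hn (hx.trans h0.symm)).trans ?_
  have h2 : Real.sqrt n ≤ n := by
    rw [Real.sqrt_le_left (by positivity)]; nlinarith
  simp only [dyadicSide, pow_zero, one_mul]
  rw [← div_eq_mul_inv, div_le_one (by positivity)]
  exact h2

end dyadic

section frostman

variable {n : ℕ}

/-- Frostman's construction stopped at generation `m`: the mass of every dyadic cell of generation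
between `j` and `m` is capped by `w`, and still dominates the size of `S` in the cells of
generation `j`. -/
lemma exists_measure_dyadicCell_le (hn : 1 ≤ n)
    (H : OuterMeasure (EuclideanSpace ℝ (Fin n))) {K : ℝ≥0∞} {w : ℕ → ℝ≥0∞}
    (hw : ∀ j, w j ≠ ⊤)
    (hH : ∀ j k, H (dyadicCell n j k) ≤ K * w j) (S : Set (EuclideanSpace ℝ (Fin n))) (m j : ℕ)
    (hj : j ≤ m) :
    ∃ μ : Measure (EuclideanSpace ℝ (Fin n)),
      μ ≤ (w m / ENNReal.ofReal (dyadicSide n m ^ n)) • volume ∧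
      μ (dyadicIndex n m ⁻¹' (dyadicIndex n m '' S))ᶜ = 0 ∧
      (∀ i, j ≤ i → i ≤ m → ∀ k, μ (dyadicCell n i k) ≤ w i) ∧
      ∀ k, H (S ∩ dyadicCell n j k) ≤ K * μ (dyadicCell n j k) := by
  have hd : ∀ i, ENNReal.ofReal (dyadicSide n i ^ n) ≠ 0 := fun i => by
    simpa using pow_pos (dyadicSide_pos hn i) n
  induction hj using Nat.decreasingInduction with
  | self =>
    set U := dyadicIndex n m ⁻¹' (dyadicIndex n m '' S) with hU
    have hUm : MeasurableSet U := measurable_dyadicIndex m (Set.to_countable _).measurableSet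
    refine ⟨(w m / ENNReal.ofReal (dyadicSide n m ^ n)) • volume.restrict U, ?_, ?_, ?_, ?_⟩
    · gcongr
      exact Measure.restrict_le_self
    · simp [Measure.restrict_apply hUm.compl]
    · intro i hi hi' k
      obtain rfl := le_antisymm hi hi'
      rw [Measure.smul_apply, smul_eq_mul]
      calc _ ≤ w m / ENNReal.ofReal (dyadicSide n m ^ n) * volume (dyadicCell n m k) := by
            gcongr; exact Measure.restrict_le_self
        _ = w m := by
          rw [volume_dyadicCell hn, ENNReal.div_mul_cancel (hd m) ENNReal.ofReal_ne_top]
    · intro k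
      rcases (S ∩ dyadicCell n m k).eq_empty_or_nonempty with h | ⟨x, hxS, hxk⟩
      · simp [h]
      · have hsub : dyadicCell n m k ⊆ U := fun y hy => ⟨x, hxS, hxk.trans hy.symm⟩
        rw [Measure.smul_apply, smul_eq_mul, Measure.restrict_apply (measurableSet_dyadicCell m k),
          inter_eq_left.2 hsub, volume_dyadicCell hn,
          ENNReal.div_mul_cancel (hd m) ENNReal.ofReal_ne_top]
        exact (measure_mono inter_subset_right).trans (hH m k)
  | of_succ j hjm ih =>
    obtain ⟨μ, h1, h2, h3, h4⟩ := ih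
    have hfin : ∀ k, μ (dyadicCell n j k) ≠ ⊤ := fun k => by
      refine ((h1 (dyadicCell n j k)).trans_lt ?_).ne
      rw [Measure.smul_apply, smul_eq_mul, volume_dyadicCell hn]
      exact ENNReal.mul_lt_top (ENNReal.div_lt_top (hw m) (hd m)) ENNReal.ofReal_lt_top
    set φ : (Fin n → ℤ) → ℝ≥0∞ := fun k => min 1 (w j / μ (dyadicCell n j k))
    set g : EuclideanSpace ℝ (Fin n) → ℝ≥0∞ := fun x => φ (dyadicIndex n j x) with hg
    have hgm : Measurable g := (measurable_of_countable φ).comp (measurable_dyadicIndex j)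
    have hle : μ.withDensity g ≤ μ := by
      calc μ.withDensity g ≤ μ.withDensity 1 :=
            withDensity_mono (Eventually.of_forall fun x => min_le_left _ _)
        _ = μ := withDensity_one
    have hval : ∀ k, μ.withDensity g (dyadicCell n j k) = min (μ (dyadicCell n j k)) (w j) := by
      intro k
      rw [withDensity_apply _ (measurableSet_dyadicCell j k),
        setLIntegral_congr_fun (g := fun _ => φ k) (measurableSet_dyadicCell j k)
          (fun x hx => by simp only [hg]; rw [show dyadicIndex n j x = k from hx])]
      rw [setLIntegral_const]
      rcases eq_or_ne (μ (dyadicCell n j k)) 0 with h0 | h0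
      · simp [h0]
      · simp only [φ]
        rw [min_mul, one_mul, ENNReal.div_mul_cancel h0 (hfin k)]
    refine ⟨μ.withDensity g, hle.trans h1, ?_, ?_, ?_⟩
    · exact le_antisymm ((hle _).trans_eq h2) bot_le
    · intro i hi hi' k
      rcases hi.eq_or_lt with rfl | hi
      · rw [hval]; exact min_le_right _ _
      · exact (hle _).trans (h3 i hi hi' k)
    · intro k
      rw [hval]
      rcases min_choice (μ (dyadicCell n j k)) (w j) with h | h <;> rw [h]
      · rw [dyadicCell_eq_iUnion, inter_iUnion, measure_iUnion (μ := μ) ?_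
          fun k' : {k' : Fin n → ℤ // (fun i => k' i / 2) = k} =>
            measurableSet_dyadicCell (j + 1) k'.1, ← ENNReal.tsum_mul_left]
        · exact (measure_iUnion_le _).trans (ENNReal.tsum_le_tsum fun k' => h4 k')
        · exact fun a b hab => pairwise_disjoint_dyadicCell (j + 1) (Subtype.coe_injective.ne hab)
      · exact (measure_mono inter_subset_right).trans (hH j k)

/-- A measure whose dyadic cells up to generation `m` have mass at most the `α`-th power of their
side, and which is diffuse below that scale, has bounded `α`-dimensional density. -/
lemma cAlpha_le_of_dyadicCell (hn : 1 ≤ n) {α : ℝ} (hα : 0 < α) (hαn : α ≤ n) {m : ℕ}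
    {μ : Measure (EuclideanSpace ℝ (Fin n))}
    (h1 : μ ≤ (ENNReal.ofReal (dyadicSide n m ^ α) /
      ENNReal.ofReal (dyadicSide n m ^ n)) • volume)
    (h2 : ∀ i ≤ m, ∀ k, μ (dyadicCell n i k) ≤ ENNReal.ofReal (dyadicSide n i ^ α))
    (h3 : μ univ ≤ ENNReal.ofReal (dyadicSide n 0 ^ α)) :
    cAlpha n α μ ≤ ENNReal.ofReal (6 ^ n) := by
  refine iSup₂_le fun x r => iSup_le fun hr => ?_
  have hrα : 0 < r ^ α := Real.rpow_pos_of_pos hr α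
  refine ENNReal.div_le_of_le_mul ?_
  rw [← ENNReal.ofReal_mul (by positivity)]
  have hδ := dyadicSide_pos hn m
  have hsucc : ∀ i, dyadicSide n 0 * (1 / 2) ^ i = dyadicSide n i := fun i => by
    simp [dyadicSide]
  rcases le_or_gt (dyadicSide n 0) r with hr0 | hr0
  · refine (measure_mono (subset_univ _)).trans (h3.trans (ENNReal.ofReal_le_ofReal ?_))
    have : dyadicSide n 0 ^ α ≤ r ^ α :=
      Real.rpow_le_rpow (dyadicSide_pos hn 0).le hr0 hα.le
    have h6 : (1 : ℝ) ≤ 6 ^ n := one_le_pow₀ (by norm_num)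
    nlinarith
  rcases lt_or_ge r (dyadicSide n m) with hrm | hrm
  · refine (h1 _).trans ?_
    rw [Measure.smul_apply, smul_eq_mul]
    refine (mul_le_mul' le_rfl (volume_ball_le x hr)).trans ?_
    rw [← ENNReal.ofReal_div_of_pos (by positivity), ← ENNReal.ofReal_mul (by positivity)]
    refine ENNReal.ofReal_le_ofReal ?_
    rw [← Real.rpow_natCast (dyadicSide n m), ← Real.rpow_sub hδ, mul_pow, ← mul_assoc,
      mul_comm _ (2 ^ n : ℝ), mul_assoc]
    refine mul_le_mul (pow_le_pow_left₀ (by norm_num) (by norm_num) n) ?_ (by positivity)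
      (by positivity)
    have h4 : dyadicSide n m ^ (α - n) ≤ r ^ (α - n) :=
      Real.rpow_le_rpow_of_nonpos hr hrm.le (by linarith)
    calc _ ≤ r ^ (α - n) * r ^ n := by gcongr
      _ = r ^ α := by rw [← Real.rpow_natCast, ← Real.rpow_add hr]; simp
  · have hℓ := dyadicSide_pos hn 0
    obtain ⟨j, hj1, hj2⟩ := exists_nat_pow_near_of_lt_one (x := r / dyadicSide n 0)
      (y := (1 / 2 : ℝ)) (by positivity) ((div_le_one hℓ).2 hr0.le) (by norm_num) (by norm_num)
    rw [lt_div_iff₀ hℓ, mul_comm, hsucc] at hj1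
    rw [div_le_iff₀ hℓ, mul_comm, hsucc] at hj2
    have hjm : j ≤ m := by
      by_contra! hc
      have : dyadicSide n j < dyadicSide n m := by
        rw [← hsucc j, ← hsucc m]
        exact mul_lt_mul_of_pos_left (pow_lt_pow_right_of_lt_one₀ (by norm_num) (by norm_num) hc) hℓ
      linarith
    have hcov : ball x r ⊆ ⋃ e ∈ Fintype.piFinset fun _ : Fin n => Finset.Icc (-1 : ℤ) 1,
        dyadicCell n j (dyadicIndex n j x + e) := by
      intro y hy
      simp only [mem_iUnion]
      refine ⟨dyadicIndex n j y - dyadicIndex n j x, ?_, ?_⟩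
      · exact Fintype.mem_piFinset.2 fun i => dyadicIndex_sub_mem hn (lt_of_lt_of_le hy hj2) i
      · show dyadicIndex n j y = _
        abel
    refine (measure_mono hcov).trans ((measure_biUnion_finset_le _ _).trans ?_)
    refine (Finset.sum_le_card_nsmul _ _ _ fun e _ => h2 j hjm _).trans ?_
    rw [Fintype.card_piFinset_const, nsmul_eq_mul, ← ENNReal.ofReal_natCast,
      ← ENNReal.ofReal_mul (by positivity)]
    refine ENNReal.ofReal_le_ofReal ?_
    have h5 : dyadicSide n j = 2 * dyadicSide n (j + 1) := by
      rw [← hsucc j, ← hsucc (j + 1)]; ring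
    have h6 : dyadicSide n j ^ α ≤ 2 ^ n * r ^ α := by
      calc dyadicSide n j ^ α ≤ (2 * r) ^ α :=
            Real.rpow_le_rpow (dyadicSide_pos hn j).le (by linarith) hα.le
        _ = 2 ^ α * r ^ α := Real.mul_rpow (by norm_num) hr.le
        _ ≤ 2 ^ (n : ℝ) * r ^ α := by
          gcongr
          norm_num
        _ = _ := by rw [Real.rpow_natCast]
    have h7 : ((((Finset.Icc (-1 : ℤ) 1).card ^ n : ℕ)) : ℝ) = 3 ^ n := by simp
    rw [h7]
    calc (3 : ℝ) ^ n * dyadicSide n j ^ α ≤ 3 ^ n * (2 ^ n * r ^ α) := by gcongr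
      _ = 6 ^ n * r ^ α := by rw [← mul_assoc, ← mul_pow]; norm_num

end frostman

section content

variable {n : ℕ} {s α C : ℝ} {F : EuclideanSpace ℝ (Fin n) → ℂ}

/-- The `α`-dimensional Hausdorff content on `ℝⁿ`. -/
noncomputable def hausdorffContent (n : ℕ) (α : ℝ) : OuterMeasure (EuclideanSpace ℝ (Fin n)) :=
  OuterMeasure.boundedBy fun A => ediam A ^ α

lemma hausdorffMeasure_eq_zero_of_hausdorffContent_eq_zero (hα : 0 < α)
    {S : Set (EuclideanSpace ℝ (Fin n))} (hS : hausdorffContent n α S = 0) :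
    (μH[α] : Measure (EuclideanSpace ℝ (Fin n))) S = 0 := by
  rw [Measure.hausdorffMeasure_apply]
  refine le_antisymm (iSup₂_le fun r hr => ?_) bot_le
  refine le_of_forall_pos_le_add fun ε hε => ?_
  rw [zero_add]
  have hε' : 0 < min ε (r ^ α) :=
    lt_min hε (ENNReal.rpow_pos_of_nonneg hr hα.le)
  rw [hausdorffContent, OuterMeasure.boundedBy_apply] at hS
  have hS' := hS.trans_lt hε'
  simp only [iInf_lt_iff] at hS'
  obtain ⟨t, ht, hsum⟩ := hS'
  have hle : ∀ i, ⨆ _ : (t i).Nonempty, ediam (t i) ^ α ≤ r ^ α := fun i =>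
    ((ENNReal.le_tsum i).trans hsum.le).trans (min_le_right _ _)
  have hdiam : ∀ i, ediam (t i) ≤ r := by
    intro i
    rcases (t i).eq_empty_or_nonempty with h | h
    · simp [h]
    · have := hle i
      rw [iSup_pos h] at this
      exact (ENNReal.rpow_le_rpow_iff hα).1 this
  exact iInf₂_le_of_le t ht (iInf_le_of_le hdiam (hsum.le.trans (min_le_left _ _)))

lemma hausdorffContent_dyadicCell_le (hn : 1 ≤ n) (hα : 0 < α) (j : ℕ) (k : Fin n → ℤ) :
    hausdorffContent n α (dyadicCell n j k) ≤
      ENNReal.ofReal (Real.sqrt n ^ α) * ENNReal.ofReal (dyadicSide n j ^ α) := by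
  have hδ := (dyadicSide_pos hn j).le
  refine (OuterMeasure.boundedBy_le _).trans ?_
  rw [← ENNReal.ofReal_mul (by positivity), ← Real.mul_rpow (by positivity) hδ,
    ← ENNReal.ofReal_rpow_of_nonneg (by positivity) hα.le]
  exact ENNReal.rpow_le_rpow (ediam_dyadicCell_le hn j k) hα.le

lemma exists_dyadicSide_mul_le (n : ℕ) (a : ℝ) {ε : ℝ} (hε : 0 < ε) :
    ∃ m, dyadicSide n m * a ≤ ε := by
  have h : Tendsto (fun m => dyadicSide n m * a) atTop (𝓝 0) := by
    have := (tendsto_pow_atTop_nhds_zero_of_lt_one (r := (1 / 2 : ℝ)) (by norm_num)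
      (by norm_num)).mul_const ((n : ℝ)⁻¹ * a)
    rw [zero_mul] at this
    refine this.congr fun m => ?_
    simp [dyadicSide]; ring
  exact (h.eventually (gt_mem_nhds hε)).exists.imp fun m hm => hm.le

/-- The weak-type content estimate that follows from the maximal estimate. -/
lemma SchwartzMaximalBound.exists_hausdorffContent_le (h : SchwartzMaximalBound n s α C)
    (hn : 1 ≤ n) (hs : 0 ≤ s) (hC : 0 ≤ C) (hα : 0 < α) (hαn : α ≤ n) :
    ∃ K : ℝ, 0 ≤ K ∧ ∀ F : EuclideanSpace ℝ (Fin n) → ℂ, Integrable F →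
      (Integrable fun ξ => (1 + ‖ξ‖ ^ 2) ^ s * ‖F ξ‖ ^ 2) →
      (∃ R : ℝ, ∀ ξ, R < ‖ξ‖ → F ξ = 0) → ∀ a : ℝ, 0 < a →
      hausdorffContent n α {x | x ∈ dyadicCell n 0 0 ∧ a < weightedMaximal n F x} ≤
        ENNReal.ofReal (K * (hsNormOfHat n s F / a) ^ 2) := by
  set B := weightSum * ((2 * Real.pi) ^ ((n : ℝ) / 2) * C) with hB
  have hB0 : 0 ≤ B := mul_nonneg weightSum_nonneg (by positivity)
  refine ⟨Real.sqrt n ^ α * (4 * B ^ 2 * 6 ^ n), by positivity, ?_⟩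
  rintro F hF hFs ⟨R, hR⟩ a ha
  have hN := hsNormOfHat_nonneg (n := n) s F
  set S := {x | x ∈ dyadicCell n 0 0 ∧ a < weightedMaximal n F x} with hS
  have hF' : Integrable fun ξ => ‖ξ‖ * ‖F ξ‖ := by
    refine (hF.norm.const_mul |R|).mono'
      (continuous_norm.aestronglyMeasurable.mul hF.1.norm) (Eventually.of_forall fun ξ => ?_)
    rw [norm_mul, norm_norm, norm_norm]
    rcases lt_or_ge R ‖ξ‖ with h | h
    · simp [hR ξ h]
    · exact mul_le_mul_of_nonneg_right (h.trans (le_abs_self R)) (norm_nonneg _)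
  obtain ⟨m, hm⟩ := exists_dyadicSide_mul_le n (Real.sqrt n * ∫ ξ, ‖ξ‖ * ‖F ξ‖) (half_pos ha)
  obtain ⟨ν, h1, h2, h3, h4⟩ := exists_measure_dyadicCell_le hn (hausdorffContent n α)
    (K := ENNReal.ofReal (Real.sqrt n ^ α)) (w := fun j => ENNReal.ofReal (dyadicSide n j ^ α))
    (fun _ => ENNReal.ofReal_ne_top) (hausdorffContent_dyadicCell_le hn hα) S m 0 (Nat.zero_le m)
  have hQ := measurableSet_dyadicCell (n := n) 0 0
  set μ := ν.restrict (dyadicCell n 0 0) with hμ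
  have hμν : μ ≤ ν := Measure.restrict_le_self
  have hμu : μ univ = ν (dyadicCell n 0 0) := by rw [hμ, Measure.restrict_apply_univ]
  have hc : cAlpha n α μ ≤ ENNReal.ofReal (6 ^ n) :=
    cAlpha_le_of_dyadicCell hn hα hαn (hμν.trans h1)
      (fun i hi k => (hμν _).trans (h3 i (Nat.zero_le i) hi k))
      (hμu.trans_le (h3 0 le_rfl (Nat.zero_le m) 0))
  have hdim : IsAlphaDimensional n α μ := by
    refine ⟨?_, (hc.trans_lt ENNReal.ofReal_lt_top).ne⟩
    rw [hμ, Measure.restrict_apply isClosed_closedBall.measurableSet.compl]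
    refine measure_mono_null (fun x hx => ?_) (measure_empty (μ := ν))
    exact hx.1 (dyadicCell_zero_subset hn hx.2)
  have hlow : ∀ᵐ x ∂μ, ENNReal.ofReal (a / 2) ≤ ENNReal.ofReal (weightedMaximal n F x) := by
    have hU : ∀ᵐ x ∂μ, x ∈ dyadicIndex n m ⁻¹' (dyadicIndex n m '' S) :=
      le_antisymm ((hμν _).trans_eq h2) bot_le
    filter_upwards [hU] with x hx
    obtain ⟨y, hy, hyx⟩ := hx
    have h5 := weightedMaximal_le_add hF hF' y x
    have h6 := dist_le_of_dyadicIndex_eq hn hyx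
    rw [dist_eq_norm] at h6
    have h7 : 0 ≤ ∫ ξ, ‖ξ‖ * ‖F ξ‖ := integral_nonneg fun ξ => by positivity
    have h8 := mul_le_mul_of_nonneg_right h6 h7
    refine ENNReal.ofReal_le_ofReal ?_
    have := hy.2
    nlinarith
  have hMtop := hdim.measure_univ_ne_top
  have hint := h.lintegral_weightedMaximal_le hs hF hR hFs hC hdim
  have hint' := (lintegral_mono_ae hlow).trans hint
  rw [lintegral_const] at hint'
  set M := (μ univ).toReal with hM
  have hM0 : 0 ≤ M := ENNReal.toReal_nonneg
  rw [← ENNReal.ofReal_toReal hMtop, ← ENNReal.ofReal_mul (by positivity),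
    ENNReal.ofReal_le_ofReal_iff (mul_nonneg weightSum_nonneg (by positivity))] at hint'
  have hc' : (cAlpha n α μ).toReal ≤ 6 ^ n := ENNReal.toReal_le_of_le_ofReal (by positivity) hc
  have hsq : a / 2 * M ≤ B * Real.sqrt (6 ^ n * M) * hsNormOfHat n s F := by
    refine hint'.trans ?_
    have : Real.sqrt ((cAlpha n α μ).toReal * M) ≤ Real.sqrt (6 ^ n * M) := by gcongr
    calc _ = B * Real.sqrt ((cAlpha n α μ).toReal * M) * hsNormOfHat n s F := by rw [hB]; ring
      _ ≤ _ := by gcongr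
  have hMle : M ≤ 4 * B ^ 2 * 6 ^ n * (hsNormOfHat n s F / a) ^ 2 := by
    have h9 := pow_le_pow_left₀ (by positivity) hsq 2
    rw [mul_pow, mul_pow, mul_pow, Real.sq_sqrt (by positivity)] at h9
    rcases hM0.eq_or_lt with h0 | h0
    · rw [← h0]; positivity
    · have h10 : (a / 2) ^ 2 * M ≤ B ^ 2 * 6 ^ n * hsNormOfHat n s F ^ 2 := by
        refine le_of_mul_le_mul_right ?_ h0
        nlinarith
      rw [div_pow, mul_div_assoc', le_div_iff₀ (by positivity)]
      nlinarith
  have hSQ : S ∩ dyadicCell n 0 0 = S := inter_eq_left.2 fun x hx => hx.1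
  have h11 := h4 0
  rw [hSQ, ← hμu, ← ENNReal.ofReal_toReal hMtop, ← ENNReal.ofReal_mul (by positivity)] at h11
  refine h11.trans (ENNReal.ofReal_le_ofReal ?_)
  rw [mul_assoc]
  gcongr

end content

section subordination

open SchwartzMap

lemma one_sub_div_pow_mem_Icc {r R : ℝ} (hr : 0 < r) (hR : r < R) :
    1 - (r / R) ^ 4 ∈ Icc (0 : ℝ) 1 := by
  have h : 0 ≤ r / R := by have := hr.trans hR; positivity
  have h1 : r / R ≤ 1 := (div_le_one (hr.trans hR)).2 hR.le
  exact ⟨by linarith [pow_le_one₀ (n := 4) h h1], by linarith [pow_nonneg h 4]⟩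

lemma SchwartzMap.integrableOn_Ioi_one_sub_div_pow_mul (W : SchwartzMap ℝ ℝ) (m : ℕ) {r : ℝ}
    (hr : 0 < r) : IntegrableOn (fun R => (1 - (r / R) ^ 4) ^ m * W R) (Ioi r) := by
  refine (W.integrable (μ := volume)).norm.integrableOn.mono' (g := fun R => ‖W R‖)
    (by fun_prop) ?_
  filter_upwards [ae_restrict_mem measurableSet_Ioi] with R hR
  have h := one_sub_div_pow_mem_Icc hr hR
  rw [norm_mul, norm_pow, Real.norm_of_nonneg h.1]
  exact mul_le_of_le_one_left (norm_nonneg _) (pow_le_one₀ h.1 h.2)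

/-- A Schwartz profile on the half-line is a superposition of dilates of `(1 - r⁴)₊ ^ m`. -/
lemma SchwartzMap.exists_eq_integral_one_sub_div_pow (ψ : SchwartzMap ℝ ℝ) (m : ℕ) :
    ∃ W : SchwartzMap ℝ ℝ, ∀ r : ℝ, 0 < r →
      ψ r = ∫ R in Ioi r, (1 - (r / R) ^ 4) ^ m * W R := by
  induction m with
  | zero =>
    refine ⟨-derivCLM ℝ ℝ ψ, fun r hr => ?_⟩
    have h := integral_Ioi_of_hasDerivAt_of_tendsto' (f := ψ) (f' := derivCLM ℝ ℝ ψ) (a := r)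
      (m := 0) (fun x _ => by simpa using ψ.hasDerivAt x)
      (derivCLM ℝ ℝ ψ).integrable.integrableOn (ψ.tendsto_cocompact.mono_left atTop_le_cocompact)
    simp only [pow_zero, one_mul, neg_apply, integral_neg, h]
    simp
  | succ m ih =>
    obtain ⟨W, hW⟩ := ih
    set c : ℝ := 1 / (4 * (m + 1)) with hc
    have hc1 : c * (4 * (m + 1)) = 1 := by rw [hc]; field_simp
    set V : SchwartzMap ℝ ℝ := smulLeftCLM ℝ (fun R : ℝ => R) W with hV
    have hVR : ∀ R, V R = R * W R := fun R => by
      rw [hV, smulLeftCLM_apply_apply (by fun_prop), smul_eq_mul]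
    refine ⟨W - c • derivCLM ℝ ℝ V, fun r hr => ?_⟩
    set W' := W - c • derivCLM ℝ ℝ V with hW'
    have hint := (W.integrableOn_Ioi_one_sub_div_pow_mul m hr).sub
      (W'.integrableOn_Ioi_one_sub_div_pow_mul (m + 1) hr)
    have hder : ∀ R ∈ Ici r, HasDerivAt (fun R => c * (1 - (r / R) ^ 4) ^ (m + 1) * V R)
        ((1 - (r / R) ^ 4) ^ m * W R - (1 - (r / R) ^ 4) ^ (m + 1) * W' R) R := by
      intro R hR
      have hR0 : R ≠ 0 := (hr.trans_le hR).ne'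
      have h1 : HasDerivAt (fun R => r / R) (-r / R ^ 2) R := by
        simpa [div_eq_mul_inv, neg_div] using (hasDerivAt_inv hR0).const_mul r
      have h2 := (((h1.pow 4).const_sub 1).pow (m + 1)).const_mul c
      refine (h2.mul (V.hasDerivAt R)).congr_deriv ?_
      simp only [hW', sub_apply, _root_.smul_apply, derivCLM_apply, hVR,
        Pi.pow_apply, smul_eq_mul, Nat.add_sub_cancel]
      have h3 : c * (((m + 1 : ℕ) : ℝ) * (1 - (r / R) ^ 4) ^ m *
          -(((4 : ℕ) : ℝ) * (r / R) ^ (4 - 1) * (-r / R ^ 2))) * (R * W R) =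
          (c * (4 * (m + 1))) * ((1 - (r / R) ^ 4) ^ m * (r / R) ^ 4 * W R) := by
        push_cast
        field_simp
      rw [h3, hc1]
      ring
    have hlim : Tendsto (fun R => c * (1 - (r / R) ^ 4) ^ (m + 1) * V R) atTop (𝓝 0) := by
      have h1 : Tendsto (fun R : ℝ => r / R) atTop (𝓝 0) := tendsto_const_nhds.div_atTop tendsto_id
      have h2 := ((((h1.pow 4).const_sub 1).pow (m + 1)).const_mul c).mul
        (V.tendsto_cocompact.mono_left atTop_le_cocompact)
      simpa using h2
    have h := integral_Ioi_of_hasDerivAt_of_tendsto' hder hint hlim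
    rw [integral_sub (W.integrableOn_Ioi_one_sub_div_pow_mul m hr)
      (W'.integrableOn_Ioi_one_sub_div_pow_mul (m + 1) hr), ← hW r hr] at h
    have h0 : 1 - (r / r) ^ 4 = 0 := by rw [div_self hr.ne']; norm_num
    simp only [h0, zero_pow (Nat.succ_ne_zero m), mul_zero, zero_mul, sub_zero] at h
    linarith

end subordination

section bochnerRiesz

lemma hasDerivAt_max_zero_pow (k : ℕ) (x : ℝ) :
    HasDerivAt (fun x : ℝ => max x 0 ^ (k + 2)) ((k + 2) * max x 0 ^ (k + 1)) x := by
  rcases lt_trichotomy x 0 with h | rfl | h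
  · have h1 : (fun x : ℝ => max x 0 ^ (k + 2)) =ᶠ[𝓝 x] fun _ => 0 := by
      filter_upwards [gt_mem_nhds h] with y hy
      rw [max_eq_right hy.le]; simp
    refine ((hasDerivAt_const x (0 : ℝ)).congr_of_eventuallyEq h1).congr_deriv ?_
    rw [max_eq_right h.le]; simp
  · rw [hasDerivAt_iff_isLittleO_nhds_zero]
    have : (fun h : ℝ => h ^ 2) =o[𝓝 0] fun h : ℝ => h := by
      simpa using Asymptotics.isLittleO_pow_id (𝕜 := ℝ) one_lt_two
    refine Asymptotics.IsBigO.trans_isLittleO ?_ this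
    refine Asymptotics.IsBigO.of_bound 1 ?_
    filter_upwards [Metric.ball_mem_nhds (0 : ℝ) one_pos] with y hy
    have hy1 : |y| < 1 := by simpa using hy
    have h2 : max y 0 ≤ |y| := max_le (le_abs_self y) (abs_nonneg y)
    have h3 : (0 : ℝ) ≤ max y 0 := le_max_right _ _
    simp only [zero_add, max_self, ne_eq, Nat.add_eq_zero_iff, OfNat.ofNat_ne_zero, and_false,
      not_false_eq_true, zero_pow, sub_zero, one_ne_zero, mul_zero, smul_zero, norm_pow, one_mul]
    rw [Real.norm_of_nonneg h3, Real.norm_eq_abs]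
    calc max y 0 ^ (k + 2) ≤ |y| ^ (k + 2) := by gcongr
      _ ≤ |y| ^ 2 := pow_le_pow_of_le_one (abs_nonneg y) hy1.le (by omega)
  · have h1 : (fun x : ℝ => max x 0 ^ (k + 2)) =ᶠ[𝓝 x] fun x => x ^ (k + 2) := by
      filter_upwards [lt_mem_nhds h] with y hy
      rw [max_eq_left hy.le]
    refine ((hasDerivAt_pow (k + 2) x).congr_of_eventuallyEq h1).congr_deriv ?_
    rw [max_eq_left h.le]; push_cast; simp

lemma contDiff_max_zero_pow (k : ℕ) : ContDiff ℝ k fun x : ℝ => max x 0 ^ (k + 1) := by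
  induction k with
  | zero => exact contDiff_zero.2 (by fun_prop)
  | succ k ih =>
    push_cast
    refine contDiff_succ_iff_deriv.2 ⟨fun x => (hasDerivAt_max_zero_pow k x).differentiableAt,
      by simp, ?_⟩
    rw [show deriv (fun x : ℝ => max x 0 ^ (k + 1 + 1)) =
        fun x : ℝ => ((k : ℝ) + 2) * max x 0 ^ (k + 1) from
      funext fun x => (hasDerivAt_max_zero_pow k x).deriv]
    exact contDiff_const.mul ih

/-- The profile `(1 - ρ²)₊⁴`. -/
noncomputable def rieszProfile (ρ : ℝ) : ℝ := max (1 - ρ ^ 2) 0 ^ 4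

lemma contDiff_rieszProfile : ContDiff ℝ 3 fun ρ => (rieszProfile ρ : ℂ) := by
  have h : ContDiff ℝ 3 fun x : ℝ => max x 0 ^ 4 := contDiff_max_zero_pow 3
  exact Complex.ofRealCLM.contDiff.comp
    (h.comp (contDiff_const.sub (contDiff_id.pow 2) : ContDiff ℝ 3 fun ρ : ℝ => 1 - ρ ^ 2))

lemma continuous_rieszProfile : Continuous rieszProfile := by unfold rieszProfile; fun_prop

lemma rieszProfile_mem_Icc (ρ : ℝ) : rieszProfile ρ ∈ Icc (0 : ℝ) 1 := by
  refine ⟨pow_nonneg (le_max_right _ _) 4, pow_le_one₀ (le_max_right _ _) (max_le ?_ zero_le_one)⟩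
  linarith [sq_nonneg ρ]

lemma rieszProfile_eq_zero {ρ : ℝ} (h : 1 ≤ ρ) : rieszProfile ρ = 0 := by
  rw [rieszProfile, max_eq_right (by nlinarith)]; simp

lemma hasCompactSupport_rieszProfile : HasCompactSupport fun ρ => (rieszProfile ρ : ℂ) := by
  refine HasCompactSupport.intro (isCompact_Icc (a := (-1 : ℝ)) (b := 1)) fun ρ hρ => ?_
  have : 1 ≤ ρ ^ 2 := by
    by_contra! h
    exact hρ (abs_le.1 ((sq_lt_one_iff_abs_lt_one ρ).1 h).le)
  rw [rieszProfile, max_eq_right (by linarith)]; simp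

end bochnerRiesz

section bochnerRieszFourier

open FourierTransform

lemma exists_norm_fourier_rieszProfile_le :
    ∃ K : ℝ, ∀ v, ‖𝓕 (fun ρ => (rieszProfile ρ : ℂ)) v‖ ≤ K * (1 + ‖v‖) ^ (-3 : ℝ) := by
  set h : ℝ → ℂ := fun ρ => (rieszProfile ρ : ℂ)
  have hint : ∀ k : ℕ, (k : ℕ∞) ≤ 3 → Integrable (iteratedDeriv k h) := fun k hk =>
    (contDiff_rieszProfile.continuous_iteratedDeriv k (by exact_mod_cast hk)).integrable_of_hasCompactSupport
      (by
        rw [iteratedDeriv_eq_iterate]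
        have : ∀ j : ℕ, HasCompactSupport (deriv^[j] h) := fun j => by
          induction j with
          | zero => exact hasCompactSupport_rieszProfile
          | succ j ih => rw [Function.iterate_succ_apply']; exact ih.deriv
        exact this k)
  have hbd : ∀ (f : ℝ → ℂ) v, ‖𝓕 f v‖ ≤ ∫ x, ‖f x‖ := fun f v =>
    VectorFourier.norm_fourierIntegral_le_integral_norm _ _ _ _ _
  have h3 := Real.fourier_iteratedDeriv (f := h) (N := 3) (n := 3) contDiff_rieszProfile hint le_rfl
  set A := ∫ x, ‖h x‖
  set B := ∫ x, ‖iteratedDeriv 3 h x‖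
  refine ⟨8 * (A + B), fun v => ?_⟩
  have hA := hbd h v
  have hB := hbd (iteratedDeriv 3 h) v
  rw [h3] at hB
  simp only [norm_smul, norm_pow, norm_mul, Complex.norm_real, Complex.norm_I, mul_one,
    Complex.norm_ofNat, Real.norm_of_nonneg Real.pi_pos.le] at hB
  have hv := norm_nonneg v
  have hB' : ‖v‖ ^ 3 * ‖𝓕 h v‖ ≤ B := by
    refine le_trans ?_ hB
    gcongr
    nlinarith [Real.pi_gt_three]
  have h1 : (0 : ℝ) < 1 + ‖v‖ := by positivity
  rw [Real.rpow_neg h1.le, ← div_eq_mul_inv, le_div_iff₀ (by positivity)]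
  have h2 : (1 + ‖v‖) ^ (3 : ℝ) ≤ 8 * (1 + ‖v‖ ^ 3) := by
    rw [show (3 : ℝ) = ((3 : ℕ) : ℝ) by norm_num, Real.rpow_natCast]
    nlinarith [sq_nonneg (‖v‖ - 1), mul_nonneg hv (sq_nonneg (‖v‖ - 1))]
  calc ‖𝓕 h v‖ * (1 + ‖v‖) ^ (3 : ℝ) ≤ ‖𝓕 h v‖ * (8 * (1 + ‖v‖ ^ 3)) := by gcongr
    _ ≤ 8 * (A + B) := by linarith

/-- The profile `(1 - ρ²)₊⁴` is a superposition of exponentials with an integrable weight. -/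
lemma exists_rieszProfile_eq_integral : ∃ g : ℝ → ℂ, Continuous g ∧ Integrable g ∧
    Integrable (fun v => (2 + 2 * Real.pi * |v|) ^ (3 / 2 : ℝ) * ‖g v‖) ∧
    ∀ ρ : ℝ, (rieszProfile ρ : ℂ) =
      ∫ v : ℝ, g v * Complex.exp (((2 * Real.pi * v * ρ : ℝ) : ℂ) * Complex.I) := by
  set h : ℝ → ℂ := fun ρ => (rieszProfile ρ : ℂ)
  obtain ⟨K, hK⟩ := exists_norm_fourier_rieszProfile_le
  have hh : Integrable h :=
    contDiff_rieszProfile.continuous.integrable_of_hasCompactSupport hasCompactSupport_rieszProfile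
  have hc : Continuous (𝓕 h) := VectorFourier.fourierIntegral_continuous
    Real.continuous_fourierChar (by exact continuous_inner) hh
  have hw : Integrable fun v : ℝ => (1 + ‖v‖) ^ (-(3 / 2) : ℝ) :=
    integrable_one_add_norm (by simp; norm_num)
  have hK' : ∀ v, (1 + ‖v‖) ^ (3 / 2 : ℝ) * ‖𝓕 h v‖ ≤ K * (1 + ‖v‖) ^ (-(3 / 2) : ℝ) := by
    intro v
    have h1 : (0 : ℝ) < 1 + ‖v‖ := by positivity
    calc _ ≤ (1 + ‖v‖) ^ (3 / 2 : ℝ) * (K * (1 + ‖v‖) ^ (-3 : ℝ)) := by gcongr; exact hK v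
      _ = K * ((1 + ‖v‖) ^ (3 / 2 : ℝ) * (1 + ‖v‖) ^ (-3 : ℝ)) := by ring
      _ = _ := by rw [← Real.rpow_add h1]; norm_num
  have hi : Integrable fun v => (2 + 2 * Real.pi * |v|) ^ (3 / 2 : ℝ) * ‖𝓕 h v‖ := by
    refine (hw.const_mul ((2 * Real.pi) ^ (3 / 2 : ℝ) * K)).mono'
      (Continuous.aestronglyMeasurable (by fun_prop (disch := norm_num))) ?_
    refine Eventually.of_forall fun v => ?_
    rw [Real.norm_of_nonneg (by positivity)]
    calc (2 + 2 * Real.pi * |v|) ^ (3 / 2 : ℝ) * ‖𝓕 h v‖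
        ≤ (2 * Real.pi * (1 + ‖v‖)) ^ (3 / 2 : ℝ) * ‖𝓕 h v‖ := by
          gcongr
          rw [Real.norm_eq_abs]
          nlinarith [Real.pi_gt_three, abs_nonneg v]
      _ = (2 * Real.pi) ^ (3 / 2 : ℝ) * ((1 + ‖v‖) ^ (3 / 2 : ℝ) * ‖𝓕 h v‖) := by
          rw [Real.mul_rpow (by positivity) (by positivity)]; ring
      _ ≤ _ := by
          rw [mul_assoc]
          exact mul_le_mul_of_nonneg_left (hK' v) (by positivity)
  have hg : Integrable (𝓕 h) := by
    refine hi.mono' hc.aestronglyMeasurable (Eventually.of_forall fun v => ?_)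
    refine le_mul_of_one_le_left (norm_nonneg _) (Real.one_le_rpow ?_ (by norm_num))
    nlinarith [Real.pi_pos, mul_nonneg Real.pi_pos.le (abs_nonneg v)]
  refine ⟨𝓕 h, hc, hg, hi, fun ρ => ?_⟩
  have hinv := congrFun (contDiff_rieszProfile.continuous.fourierInv_fourier_eq hh hg) ρ
  rw [Real.fourierInv_eq'] at hinv
  refine hinv.symm.trans (integral_congr_ae (Eventually.of_forall fun v => ?_))
  simp only [smul_eq_mul]
  rw [mul_comm]
  congr 3
  simp; ring

end bochnerRieszFourier

section domination

variable {n : ℕ} {F : EuclideanSpace ℝ (Fin n) → ℂ}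

/-- Bochner-Riesz cutoffs of a solution without low frequencies are controlled by the weighted
maximal function. -/
lemma exists_norm_freeEvol_rieszProfile_le (n : ℕ) : ∃ A : ℝ, 0 ≤ A ∧
    ∀ F : EuclideanSpace ℝ (Fin n) → ℂ, Integrable F → (∀ ξ, ‖ξ‖ ≤ 1 → F ξ = 0) →
    ∀ ρ > 0, ∀ t ∈ Ico (0 : ℝ) 1, ∀ x,
      ‖freeEvol n (fun ξ => (rieszProfile (‖ξ‖ ^ 2 / ρ ^ 2) : ℂ) * F ξ) t x‖ ≤
        A * weightedMaximal n F x := by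
  obtain ⟨g, hgc, hg, hgi, hgr⟩ := exists_rieszProfile_eq_integral
  refine ⟨∫ v, (2 + 2 * Real.pi * |v|) ^ (3 / 2 : ℝ) * ‖g v‖,
    integral_nonneg fun v => by positivity, ?_⟩
  intro F hF hF1 ρ hρ t ht x
  have hw := weightedMaximal_nonneg F x
  rcases le_or_gt ρ 1 with h1 | h1
  · have : (fun ξ => (rieszProfile (‖ξ‖ ^ 2 / ρ ^ 2) : ℂ) * F ξ) = fun _ => 0 := by
      funext ξ
      rcases le_or_gt ‖ξ‖ 1 with h2 | h2
      · rw [hF1 ξ h2, mul_zero]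
      · rw [rieszProfile_eq_zero, Complex.ofReal_zero, zero_mul]
        rw [one_le_div (by positivity)]
        nlinarith
    rw [this]
    simp only [freeEvol, zero_mul, integral_zero, norm_zero]
    exact mul_nonneg (integral_nonneg fun v => by positivity) hw
  · have hphase : ∀ v ξ, Complex.exp (((2 * Real.pi * v * (‖ξ‖ ^ 2 / ρ ^ 2) : ℝ) : ℂ) * Complex.I) *
        schroPhase n t x ξ = schroPhase n (t - 2 * Real.pi * v / ρ ^ 2) x ξ := by
      intro v ξ
      rw [schroPhase_eq_exp_ofReal_mul_I, schroPhase_eq_exp_ofReal_mul_I, ← Complex.exp_add,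
        ← add_mul, ← Complex.ofReal_add]
      congr 3
      ring
    have hprod : Integrable (Function.uncurry fun (ξ : EuclideanSpace ℝ (Fin n)) (v : ℝ) =>
        g v * (F ξ * schroPhase n (t - 2 * Real.pi * v / ρ ^ 2) x ξ)) (volume.prod volume) := by
      refine (hF.norm.mul_prod hg.norm).mono' ?_ (Eventually.of_forall fun p => ?_)
      · refine (hg.1.comp_snd).mul ((hF.1.comp_fst).mul ?_)
        refine Continuous.aestronglyMeasurable ?_
        unfold schroPhase
        fun_prop
      · simp [Function.uncurry, mul_comm]
    have heq : freeEvol n (fun ξ => (rieszProfile (‖ξ‖ ^ 2 / ρ ^ 2) : ℂ) * F ξ) t x =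
        ∫ v, g v * freeEvol n F (t - 2 * Real.pi * v / ρ ^ 2) x := by
      calc _ = ∫ ξ, ∫ v, g v * (F ξ * schroPhase n (t - 2 * Real.pi * v / ρ ^ 2) x ξ) := by
            refine integral_congr_ae (Eventually.of_forall fun ξ => ?_)
            simp only
            rw [hgr, mul_assoc, ← integral_mul_const]
            refine integral_congr_ae (Eventually.of_forall fun v => ?_)
            simp only
            rw [← hphase]; ring
        _ = ∫ v, ∫ ξ, g v * (F ξ * schroPhase n (t - 2 * Real.pi * v / ρ ^ 2) x ξ) :=
            integral_integral_swap hprod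
        _ = _ := by
            refine integral_congr_ae (Eventually.of_forall fun v => ?_)
            simp only [freeEvol]
            rw [integral_const_mul]
    rw [heq, ← integral_mul_const]
    refine norm_integral_le_of_norm_le (hgi.mul_const _) (Eventually.of_forall fun v => ?_)
    rw [norm_mul, mul_comm ((2 + 2 * Real.pi * |v|) ^ (3 / 2 : ℝ)) ‖g v‖, mul_assoc ‖g v‖]
    refine mul_le_mul_of_nonneg_left ?_ (norm_nonneg _)
    refine (norm_freeEvol_le_weightedMaximal F _ x).trans ?_
    refine mul_le_mul_of_nonneg_right (Real.rpow_le_rpow (by positivity) ?_ (by norm_num)) hw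
    have h2 : |2 * Real.pi * v / ρ ^ 2| ≤ 2 * Real.pi * |v| := by
      rw [abs_div, abs_mul, abs_of_pos (by positivity : 0 < 2 * Real.pi),
        abs_of_pos (by positivity : 0 < ρ ^ 2)]
      exact div_le_self (by positivity) (by nlinarith)
    have h3 := abs_sub t (2 * Real.pi * v / ρ ^ 2)
    rw [abs_of_nonneg ht.1] at h3
    linarith [ht.2]

/-- Smooth frequency truncations of a solution without low frequencies are controlled by the
weighted maximal function. -/
lemma exists_norm_schroPartial_le (n : ℕ) (ψ : SchwartzMap ℝ ℝ) : ∃ A : ℝ, 0 ≤ A ∧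
    ∀ F : EuclideanSpace ℝ (Fin n) → ℂ, Integrable F → (∀ ξ, ‖ξ‖ ≤ 1 → F ξ = 0) →
    ∀ N > 0, ∀ t ∈ Ico (0 : ℝ) 1, ∀ x,
      ‖schroPartial n ψ F x t N‖ ≤ A * weightedMaximal n F x := by
  obtain ⟨W, hW⟩ := ψ.exists_eq_integral_one_sub_div_pow 4
  obtain ⟨A, hA, hbd⟩ := exists_norm_freeEvol_rieszProfile_le n
  refine ⟨(∫ R in Ioi 0, ‖W R‖) * A, mul_nonneg (integral_nonneg fun R => norm_nonneg _) hA, ?_⟩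
  intro F hF hF1 N hN t ht x
  have hψ : ∀ ξ : EuclideanSpace ℝ (Fin n), ξ ≠ 0 → ψ (‖ξ‖ / N) =
      ∫ R in Ioi 0, rieszProfile (‖ξ‖ ^ 2 / (N * R) ^ 2) * W R := by
    intro ξ hξ
    have hr : 0 < ‖ξ‖ / N := by have := norm_pos_iff.2 hξ; positivity
    rw [hW _ hr]
    have hsub : Ioi (‖ξ‖ / N) ⊆ Ioi 0 := Ioi_subset_Ioi hr.le
    rw [setIntegral_eq_of_subset_of_forall_sdiff_eq_zero
      (f := fun R => rieszProfile (‖ξ‖ ^ 2 / (N * R) ^ 2) * W R) measurableSet_Ioi hsub]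
    · refine setIntegral_congr_fun measurableSet_Ioi fun R hR => ?_
      have h := one_sub_div_pow_mem_Icc hr hR
      have hR0 : 0 < R := hr.trans hR
      have h2 : 1 - (‖ξ‖ ^ 2 / (N * R) ^ 2) ^ 2 = 1 - (‖ξ‖ / N / R) ^ 4 := by
        field_simp
      simp only [rieszProfile]
      rw [h2, max_eq_left h.1]
    · intro R hR
      have hR0 : 0 < R := hR.1
      have hR1 : R ≤ ‖ξ‖ / N := not_lt.1 hR.2
      rw [rieszProfile_eq_zero, zero_mul]
      rw [one_le_div (by positivity)]
      rw [le_div_iff₀ hN] at hR1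
      nlinarith [mul_pos hN hR0]
  have hWi : Integrable (fun R => ‖W R‖) (volume.restrict (Ioi 0)) := W.integrable.norm.restrict
  have hprod : Integrable (Function.uncurry fun (ξ : EuclideanSpace ℝ (Fin n)) (R : ℝ) =>
      (W R : ℂ) * ((rieszProfile (‖ξ‖ ^ 2 / (N * R) ^ 2) : ℂ) * F ξ * schroPhase n t x ξ))
      (volume.prod (volume.restrict (Ioi 0))) := by
    refine (hF.norm.mul_prod hWi).mono' ?_ (Eventually.of_forall fun p => ?_)
    · refine AEStronglyMeasurable.mul ?_ (AEStronglyMeasurable.mul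
        (AEStronglyMeasurable.mul ?_ hF.1.comp_fst) ?_)
      · exact (Complex.continuous_ofReal.comp (W.continuous.comp continuous_snd)).aestronglyMeasurable
      · refine (Measurable.aestronglyMeasurable ?_)
        refine Complex.measurable_ofReal.comp (continuous_rieszProfile.measurable.comp ?_)
        fun_prop
      · exact ((continuous_schroPhase_freq t x).comp continuous_fst).aestronglyMeasurable
    · have h := rieszProfile_mem_Icc (‖p.1‖ ^ 2 / (N * p.2) ^ 2)
      simp only [Function.uncurry, norm_mul, Complex.norm_real, norm_schroPhase, mul_one]
      rw [Real.norm_of_nonneg h.1, mul_comm]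
      gcongr
      exact mul_le_of_le_one_left (norm_nonneg _) h.2
  have heq : schroPartial n ψ F x t N = ∫ R in Ioi 0, (W R : ℂ) *
      freeEvol n (fun ξ => (rieszProfile (‖ξ‖ ^ 2 / (N * R) ^ 2) : ℂ) * F ξ) t x := by
    calc _ = ∫ ξ, ∫ R in Ioi 0, (W R : ℂ) *
          ((rieszProfile (‖ξ‖ ^ 2 / (N * R) ^ 2) : ℂ) * F ξ * schroPhase n t x ξ) := by
          refine integral_congr_ae (Eventually.of_forall fun ξ => ?_)
          simp only
          rcases eq_or_ne ξ 0 with h0 | h0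
          · rw [hF1 ξ (by rw [h0]; simp)]; simp
          · rw [hψ ξ h0, ← integral_complex_ofReal, mul_assoc, ← integral_mul_const]
            refine integral_congr_ae (Eventually.of_forall fun R => ?_)
            simp only [schroPhase]
            push_cast
            ring
      _ = ∫ R in Ioi 0, ∫ ξ, (W R : ℂ) *
          ((rieszProfile (‖ξ‖ ^ 2 / (N * R) ^ 2) : ℂ) * F ξ * schroPhase n t x ξ) :=
          integral_integral_swap hprod
      _ = _ := by
          refine integral_congr_ae (Eventually.of_forall fun R => ?_)
          simp only [freeEvol]
          rw [integral_const_mul]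
  rw [heq, mul_assoc, ← integral_mul_const]
  refine norm_integral_le_of_norm_le (hWi.mul_const _) ?_
  filter_upwards [ae_restrict_mem measurableSet_Ioi] with R hR
  rw [norm_mul, Complex.norm_real]
  exact mul_le_mul_of_nonneg_left (hbd F hF hF1 (N * R) (mul_pos hN hR) t ht x) (norm_nonneg _)

end domination

/-- A family that is uniformly approximated by families with continuous limits converges, and its
limit is continuous at the left endpoint. -/
lemma exists_tendsto_of_dist_le {U : ℝ → ℝ → ℂ} {f : ℕ → ℝ → ℝ → ℂ} {l : ℕ → ℝ → ℂ}
    {e : ℕ → ℝ} (he : Tendsto e atTop (𝓝 0))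
    (hU : ∀ᶠ k in atTop, ∀ N > 0, ∀ t ∈ Ico (0 : ℝ) 1, dist (f k t N) (U t N) ≤ e k)
    (hf : ∀ k t, Tendsto (f k t) atTop (𝓝 (l k t))) (hl : ∀ k, Continuous (l k)) :
    ∃ L : ℝ → ℂ, (∀ t ∈ Ico (0 : ℝ) 1, Tendsto (U t) atTop (𝓝 (L t))) ∧
      Tendsto L (𝓝[>] 0) (𝓝 (L 0)) := by
  have hlim : ∀ t, ∃ L, t ∈ Ico (0 : ℝ) 1 → Tendsto (U t) atTop (𝓝 L) := by
    intro t
    by_cases ht : t ∈ Ico (0 : ℝ) 1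
    · refine (cauchySeq_tendsto_of_complete (u := U t) ?_).imp fun L hL _ => hL
      refine Metric.cauchySeq_iff'.2 fun ε hε => ?_
      obtain ⟨k, hk, hke⟩ := (hU.and (he.eventually_lt_const (by positivity : 0 < ε / 4))).exists
      have hev := (Metric.tendsto_nhds.1 (hf k t) (ε / 4) (by positivity)).and (eventually_gt_atTop 0)
      obtain ⟨M, hM⟩ := eventually_atTop.1 hev
      refine ⟨M, fun N hN => ?_⟩
      have h1 := hk N (hM N hN).2 t ht
      have h2 := hk M (hM M le_rfl).2 t ht
      have h3 := (hM N hN).1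
      have h4 := (hM M le_rfl).1
      have h5 := dist_triangle4 (U t N) (f k t N) (f k t M) (U t M)
      have h6 := dist_triangle_right (f k t N) (f k t M) (l k t)
      rw [dist_comm] at h1
      linarith
    · exact ⟨0, fun h => absurd h ht⟩
  choose L hL using hlim
  have hlL : ∀ᶠ k in atTop, ∀ t ∈ Ico (0 : ℝ) 1, dist (l k t) (L t) ≤ e k := by
    filter_upwards [hU] with k hk t ht
    refine le_of_tendsto ((hf k t).dist (hL t ht)) ?_
    filter_upwards [eventually_gt_atTop 0] with N hN using hk N hN t ht
  refine ⟨L, hL, ?_⟩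
  have hunif : TendstoUniformlyOn l L atTop (Ico 0 1) := by
    refine Metric.tendstoUniformlyOn_iff.2 fun ε hε => ?_
    filter_upwards [hlL, he.eventually_lt_const hε] with k hk hke t ht
    rw [dist_comm]
    exact (hk t ht).trans_lt hke
  have hc := (hunif.continuousOn (Frequently.of_forall fun k => (hl k).continuousOn)) 0
    ⟨le_rfl, one_pos⟩
  rw [ContinuousWithinAt, nhdsWithin_Ico_eq_nhdsGE one_pos] at hc
  exact hc.mono_left (nhdsWithin_mono _ Ioi_subset_Ici_self)

section convergence

variable {n : ℕ} {F : EuclideanSpace ℝ (Fin n) → ℂ}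

lemma continuous_freeEvol_time (hF : Integrable F) (x : EuclideanSpace ℝ (Fin n)) :
    Continuous fun t => freeEvol n F t x := by
  have h : Continuous fun t : ℝ => (t, x) := by fun_prop
  simpa only [Function.comp_def] using (continuous_freeEvol hF).comp h

lemma schroPartial_eq_freeEvol (ψ : SchwartzMap ℝ ℝ) (F : EuclideanSpace ℝ (Fin n) → ℂ)
    (x : EuclideanSpace ℝ (Fin n)) (t N : ℝ) :
    schroPartial n ψ F x t N = freeEvol n (fun ξ => (ψ (‖ξ‖ / N) : ℂ) * F ξ) t x := rfl

lemma continuous_ofReal_schwartz_norm_div (ψ : SchwartzMap ℝ ℝ) (N : ℝ) :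
    Continuous fun ξ : EuclideanSpace ℝ (Fin n) => (ψ (‖ξ‖ / N) : ℂ) :=
  Complex.continuous_ofReal.comp (ψ.continuous.comp (by fun_prop))

lemma memLp_two_schwartz_norm_div (n : ℕ) (ψ : SchwartzMap ℝ ℝ) {N : ℝ} (hN : 0 < N) :
    MemLp (fun ξ : EuclideanSpace ℝ (Fin n) => (ψ (‖ξ‖ / N) : ℂ)) 2 := by
  rw [memLp_two_iff_integrable_sq_norm
    (continuous_ofReal_schwartz_norm_div ψ N).aestronglyMeasurable]
  obtain ⟨K, hK⟩ : ∃ K, ∀ y, (1 + ‖y‖) ^ (n + 1) * ‖ψ y‖ ≤ K := ⟨_, fun y => by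
    have := SchwartzMap.one_add_le_sup_seminorm_apply (𝕜 := ℝ) (m := (n + 1, 0)) le_rfl le_rfl ψ y
    rwa [norm_iteratedFDeriv_zero] at this⟩
  have hi : Integrable fun ξ : EuclideanSpace ℝ (Fin n) => (1 + ‖ξ‖) ^ (-(2 * (n + 1) : ℝ)) :=
    integrable_one_add_norm (by
      rw [finrank_euclideanSpace_fin]
      linarith [n.cast_nonneg (α := ℝ)])
  refine ((hi.comp_smul (inv_ne_zero hN.ne')).const_mul (K ^ 2)).mono'
    ((continuous_ofReal_schwartz_norm_div ψ N).norm.pow 2).aestronglyMeasurable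
    (Eventually.of_forall fun ξ => ?_)
  have h1 := hK (‖ξ‖ / N)
  have h2 : ‖N⁻¹ • ξ‖ = ‖‖ξ‖ / N‖ := by
    rw [norm_smul, norm_inv, norm_div, norm_norm, div_eq_inv_mul]
  have h3 : 0 < 1 + ‖‖ξ‖ / N‖ := by positivity
  rw [h2, Real.rpow_neg h3.le, ← div_eq_mul_inv, le_div_iff₀ (by positivity), norm_pow, norm_norm,
    Complex.norm_real, show (2 * (n + 1) : ℝ) = (((n + 1) * 2 : ℕ) : ℝ) by push_cast; ring,
    Real.rpow_natCast, pow_mul, mul_comm, ← mul_pow]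
  gcongr

lemma integrable_schwartz_norm_div_mul (ψ : SchwartzMap ℝ ℝ) (hF : MemLp F 2) {N : ℝ}
    (hN : 0 < N) : Integrable fun ξ => (ψ (‖ξ‖ / N) : ℂ) * F ξ :=
  (memLp_two_schwartz_norm_div n ψ hN).integrable_mul hF

lemma integrable_indicator_closedBall (hF : MemLp F 2) (R : ℝ) :
    Integrable ((closedBall 0 R).indicator F) := by
  rw [integrable_indicator_iff measurableSet_closedBall]
  have : IsFiniteMeasure ((volume : Measure (EuclideanSpace ℝ (Fin n))).restrict (closedBall 0 R)) :=
    ⟨by simpa using measure_closedBall_lt_top⟩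
  exact (hF.restrict _).integrable (by norm_num)

/-- The truncated solutions converge as the frequency cutoff is removed. -/
lemma tendsto_schroPartial_atTop (ψ : SchwartzMap ℝ ℝ) (hF : Integrable F)
    (x : EuclideanSpace ℝ (Fin n)) (t : ℝ) :
    Tendsto (schroPartial n ψ F x t) atTop (𝓝 ((ψ 0 : ℂ) * freeEvol n F t x)) := by
  have h : (ψ 0 : ℂ) * freeEvol n F t x = ∫ ξ, (ψ 0 : ℂ) * F ξ * schroPhase n t x ξ := by
    rw [freeEvol, ← integral_const_mul]
    simp only [mul_assoc]
  rw [h]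
  refine tendsto_integral_filter_of_dominated_convergence
    (fun ξ => SchwartzMap.seminorm ℝ 0 0 ψ * ‖F ξ‖) ?_ ?_ (hF.norm.const_mul _) ?_
  · exact Eventually.of_forall fun N => ((continuous_ofReal_schwartz_norm_div ψ
      N).aestronglyMeasurable.mul hF.1).mul (continuous_schroPhase_freq t x).aestronglyMeasurable
  · refine Eventually.of_forall fun N => Eventually.of_forall fun ξ => ?_
    change ‖(ψ (‖ξ‖ / N) : ℂ) * F ξ * schroPhase n t x ξ‖ ≤ _
    rw [norm_mul, norm_schroPhase, mul_one, norm_mul, Complex.norm_real]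
    gcongr
    exact ψ.norm_le_seminorm ℝ _
  · refine Eventually.of_forall fun ξ => ?_
    refine Tendsto.mul_const _ (Tendsto.mul_const _ ?_)
    have h1 : Tendsto (fun N : ℝ => ‖ξ‖ / N) atTop (𝓝 0) := tendsto_const_nhds.div_atTop tendsto_id
    exact (Complex.continuous_ofReal.tendsto _).comp ((ψ.continuous.tendsto 0).comp h1)

/-- Convergence of the solutions truncated to balls of growing radius in frequency. -/
lemma tendsto_schroPartial_indicator (ψ : SchwartzMap ℝ ℝ) (hF : MemLp F 2) {R : ℕ → ℝ}
    (hR : Tendsto R atTop atTop) (x : EuclideanSpace ℝ (Fin n)) (t : ℝ) {N : ℝ} (hN : 0 < N) :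
    Tendsto (fun j => schroPartial n ψ ((closedBall 0 (R j)).indicator F) x t N) atTop
      (𝓝 (schroPartial n ψ F x t N)) := by
  refine tendsto_integral_of_dominated_convergence (fun ξ => ‖(ψ (‖ξ‖ / N) : ℂ) * F ξ‖) ?_
    (integrable_schwartz_norm_div_mul ψ hF hN).norm ?_ ?_
  · exact fun j => ((continuous_ofReal_schwartz_norm_div ψ N).aestronglyMeasurable.mul
      (hF.1.indicator measurableSet_closedBall)).mul
        (continuous_schroPhase_freq t x).aestronglyMeasurable
  · refine fun j => Eventually.of_forall fun ξ => ?_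
    change ‖(ψ (‖ξ‖ / N) : ℂ) * _ * schroPhase n t x ξ‖ ≤ _
    rw [norm_mul, norm_schroPhase, mul_one, norm_mul, norm_mul]
    gcongr
    exact norm_indicator_le_norm_self _ _
  · refine Eventually.of_forall fun ξ => tendsto_const_nhds.congr' ?_
    filter_upwards [hR.eventually_ge_atTop ‖ξ‖] with j hj
    rw [indicator_of_mem (by simpa using hj)]

/-- Geometric decay of the maximal functions of the frequency annuli at `x` gives uniform
approximation of the solution at `x` by its frequency truncations. -/
lemma exists_dist_schroPartial_indicator_le (ψ : SchwartzMap ℝ ℝ) (hF : MemLp F 2) {R : ℕ → ℝ}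
    (hR1 : ∀ j, 1 ≤ R j) (hRm : Monotone R) (hR : Tendsto R atTop atTop)
    {x : EuclideanSpace ℝ (Fin n)}
    (hx : ∀ᶠ j in atTop, weightedMaximal n
      ((closedBall 0 (R (j + 1)) \ closedBall 0 (R j)).indicator F) x ≤ (1 / 2) ^ j) :
    ∃ A : ℝ, ∀ᶠ k in atTop, ∀ N > 0, ∀ t ∈ Ico (0 : ℝ) 1,
      dist (schroPartial n ψ ((closedBall 0 (R k)).indicator F) x t N)
        (schroPartial n ψ F x t N) ≤ A * (1 / 2) ^ k := by
  obtain ⟨A, hA, hbd⟩ := exists_norm_schroPartial_le n ψ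
  obtain ⟨J, hJ⟩ := eventually_atTop.1 hx
  have hI : ∀ k, Integrable ((closedBall 0 (R k)).indicator F) := fun k =>
    integrable_indicator_closedBall hF (R k)
  have hdiff : ∀ k, ((closedBall 0 (R (k + 1)) \ closedBall 0 (R k)).indicator F) =
      fun ξ => (closedBall 0 (R (k + 1))).indicator F ξ - (closedBall 0 (R k)).indicator F ξ :=
    fun k => indicator_sdiff (closedBall_subset_closedBall (hRm k.le_succ)) F
  refine ⟨2 * A, ?_⟩
  filter_upwards [eventually_ge_atTop J] with k hk N hN t ht
  set f : ℕ → ℂ := fun k => schroPartial n ψ ((closedBall 0 (R k)).indicator F) x t N with hfdef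
  have hlim : Tendsto f atTop (𝓝 (schroPartial n ψ F x t N)) :=
    tendsto_schroPartial_indicator ψ hF hR x t hN
  have hstep : ∀ k ≥ J, dist (f k) (f (k + 1)) ≤ A * (1 / 2) ^ k := by
    intro k hk
    have hint : ∀ k, Integrable fun ξ =>
        (ψ (‖ξ‖ / N) : ℂ) * (closedBall 0 (R k)).indicator F ξ := fun k =>
      integrable_schwartz_norm_div_mul ψ (hF.indicator measurableSet_closedBall) hN
    have heq : f (k + 1) - f k = schroPartial n ψ
        ((closedBall 0 (R (k + 1)) \ closedBall 0 (R k)).indicator F) x t N := by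
      rw [hdiff, schroPartial_eq_freeEvol]
      simp only [mul_sub]
      rw [freeEvol_sub (hint _) (hint _)]
      rfl
    rw [dist_comm, dist_eq_norm, heq]
    refine (hbd _ ?_ ?_ N hN t ht x).trans (mul_le_mul_of_nonneg_left (hJ k hk) hA)
    · rw [hdiff]; exact (hI _).sub (hI _)
    · intro ξ hξ
      refine indicator_of_notMem (fun h => h.2 ?_) F
      simpa using hξ.trans (hR1 k)
  clear_value f
  have h := dist_le_of_le_geometric_two_of_tendsto (f := fun j => f (j + k))
    (C := 2 * A * (1 / 2) ^ k) (fun j => ?_) ((tendsto_add_atTop_iff_nat k).2 hlim) 0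
  · simpa [hfdef] using h
  · have h1 := hstep (j + k) (by omega)
    rw [show j + k + 1 = j + 1 + k by omega] at h1
    refine h1.trans_eq ?_
    rw [pow_add, one_div, inv_pow, inv_pow]
    ring

/-- If the maximal functions of the frequency annuli decay geometrically at `x`, the solution
converges at `x`. -/
lemma notMem_schroDivergenceSet (ψ : SchwartzMap ℝ ℝ) (hF : MemLp F 2) {R : ℕ → ℝ}
    (hR1 : ∀ j, 1 ≤ R j) (hRm : Monotone R) (hR : Tendsto R atTop atTop)
    {x : EuclideanSpace ℝ (Fin n)}
    (hx : ∀ᶠ j in atTop, weightedMaximal n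
      ((closedBall 0 (R (j + 1)) \ closedBall 0 (R j)).indicator F) x ≤ (1 / 2) ^ j) :
    x ∉ schroDivergenceSet n ψ F := by
  have hI : ∀ k, Integrable ((closedBall 0 (R k)).indicator F) := fun k =>
    integrable_indicator_closedBall hF (R k)
  obtain ⟨A, hU⟩ := exists_dist_schroPartial_indicator_le ψ hF hR1 hRm hR hx
  have he : Tendsto (fun k : ℕ => A * (1 / 2 : ℝ) ^ k) atTop (𝓝 0) := by
    simpa using (tendsto_pow_atTop_nhds_zero_of_lt_one (r := (1 / 2 : ℝ))
      (by norm_num) (by norm_num)).const_mul A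
  have hc : ∀ k, Continuous fun t =>
      (ψ 0 : ℂ) * freeEvol n ((closedBall 0 (R k)).indicator F) t x := fun k =>
    continuous_const.mul (continuous_freeEvol_time (hI k) x)
  obtain ⟨L, hL, hL0⟩ := exists_tendsto_of_dist_le he hU
    (fun k t => tendsto_schroPartial_atTop ψ (hI k) x t) hc
  have h0 : (0 : ℝ) ∈ Ico (0 : ℝ) 1 := ⟨le_rfl, one_pos⟩
  simp only [schroDivergenceSet, Set.mem_ofPred_eq, not_not]
  refine ⟨⟨_, hL 0 h0⟩, 1, one_pos, fun t ht => ⟨_, hL t ⟨ht.1.le, ht.2⟩⟩, ?_⟩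
  have hsol : ∀ t ∈ Ico (0 : ℝ) 1, schroSol n ψ F x t = L t := fun t ht => (hL t ht).limUnder_eq
  rw [hsol 0 h0]
  refine hL0.congr' ?_
  filter_upwards [Ioo_mem_nhdsGT (one_pos : (0 : ℝ) < 1)] with t ht
  exact (hsol t ⟨ht.1.le, ht.2⟩).symm

end convergence

section divergence

variable {n : ℕ} {s α C : ℝ} {F : EuclideanSpace ℝ (Fin n) → ℂ}

/-- The mass of an integrable function outside suitable growing balls decays geometrically. -/
lemma exists_setIntegral_compl_closedBall_le {g : EuclideanSpace ℝ (Fin n) → ℝ}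
    (hg : Integrable g) : ∃ R : ℕ → ℝ, (∀ j, 1 ≤ R j) ∧ Monotone R ∧ Tendsto R atTop atTop ∧
      ∀ j, ∫ ξ in (closedBall 0 (R j))ᶜ, g ξ ≤ (1 / 8) ^ j := by
  have hlim : Tendsto (fun k : ℕ => ∫ ξ in (closedBall 0 (k : ℝ))ᶜ, g ξ) atTop (𝓝 0) := by
    have h := tendsto_setIntegral_of_antitone (μ := volume) (f := g)
      (s := fun k : ℕ => (closedBall (0 : EuclideanSpace ℝ (Fin n)) (k : ℝ))ᶜ)
      (fun k => measurableSet_closedBall.compl)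
      (fun i j hij => compl_subset_compl.2 (closedBall_subset_closedBall (by exact_mod_cast hij)))
      ⟨0, hg.integrableOn⟩
    have hempty : ⋂ k : ℕ, (closedBall (0 : EuclideanSpace ℝ (Fin n)) (k : ℝ))ᶜ = ∅ := by
      rw [← compl_iUnion, iUnion_closedBall_nat, compl_univ]
    rwa [hempty, setIntegral_empty] at h
  obtain ⟨φ, hφ, hP⟩ := extraction_forall_of_eventually
    (P := fun j k => 1 ≤ k ∧ ∫ ξ in (closedBall 0 (k : ℝ))ᶜ, g ξ ≤ (1 / 8) ^ j) fun j =>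
      (eventually_ge_atTop 1).and (hlim.eventually_le_const (by positivity))
  refine ⟨fun j => φ j, fun j => Nat.one_le_cast.2 (hP j).1,
    fun i j hij => Nat.cast_le.2 (hφ.monotone hij), ?_, fun j => (hP j).2⟩
  exact tendsto_natCast_atTop_atTop.comp hφ.tendsto_atTop

lemma memLp_two_of_integrable_weight (hs : 0 ≤ s) (hF : AEStronglyMeasurable F)
    (hFs : Integrable fun ξ => (1 + ‖ξ‖ ^ 2) ^ s * ‖F ξ‖ ^ 2) : MemLp F 2 := by
  refine (memLp_two_japaneseWeight_smul hF hFs).of_le hF (Eventually.of_forall fun ξ => ?_)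
  have h := one_le_japaneseWeight (div_nonneg hs zero_le_two) ξ
  rw [norm_smul, Real.norm_of_nonneg (zero_le_one.trans h)]
  exact le_mul_of_one_le_left (norm_nonneg _) h

/-- The part of the divergence set in the unit cell is a null set for the Hausdorff measure. -/
lemma SchwartzMaximalBound.hausdorffMeasure_inter_dyadicCell (h : SchwartzMaximalBound n s α C)
    (hn : 1 ≤ n) (hs : 0 ≤ s) (hC : 0 ≤ C) (hα : 0 < α) (hαn : α ≤ n) (ψ : SchwartzMap ℝ ℝ)
    (hF : AEStronglyMeasurable F)
    (hFs : Integrable fun ξ => (1 + ‖ξ‖ ^ 2) ^ s * ‖F ξ‖ ^ 2) :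
    (μH[α] : Measure (EuclideanSpace ℝ (Fin n)))
      (schroDivergenceSet n ψ F ∩ dyadicCell n 0 0) = 0 := by
  have hF2 := memLp_two_of_integrable_weight hs hF hFs
  obtain ⟨K, hK, hcont⟩ := h.exists_hausdorffContent_le hn hs hC hα hαn
  obtain ⟨R, hR1, hRm, hR, htail⟩ := exists_setIntegral_compl_closedBall_le hFs
  set A : ℕ → Set (EuclideanSpace ℝ (Fin n)) := fun j =>
    closedBall 0 (R (j + 1)) \ closedBall 0 (R j)
  have hAm : ∀ j, MeasurableSet (A j) := fun j =>
    MeasurableSet.diff measurableSet_closedBall measurableSet_closedBall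
  have hind : ∀ j, (fun ξ => (1 + ‖ξ‖ ^ 2) ^ s * ‖(A j).indicator F ξ‖ ^ 2) =
      (A j).indicator fun ξ => (1 + ‖ξ‖ ^ 2) ^ s * ‖F ξ‖ ^ 2 := by
    intro j
    funext ξ
    by_cases hξ : ξ ∈ A j <;> simp [hξ]
  have hnorm : ∀ j, hsNormOfHat n s ((A j).indicator F) ^ 2 ≤ (1 / 8) ^ j := by
    intro j
    rw [hsNormOfHat_sq, hind, integral_indicator (hAm j)]
    refine le_trans ?_ (htail j)
    exact setIntegral_mono_set hFs.integrableOn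
      (Eventually.of_forall fun ξ => by positivity)
      (Eventually.of_forall fun ξ hξ => hξ.2)
  set S : ℕ → Set (EuclideanSpace ℝ (Fin n)) := fun j =>
    {x | x ∈ dyadicCell n 0 0 ∧ (1 / 2 : ℝ) ^ j < weightedMaximal n ((A j).indicator F) x}
  have hS : ∀ j, hausdorffContent n α (S j) ≤ ENNReal.ofReal (K * (1 / 2) ^ j) := by
    intro j
    have hdiff : (A j).indicator F = fun ξ =>
        (closedBall 0 (R (j + 1))).indicator F ξ - (closedBall 0 (R j)).indicator F ξ :=
      indicator_sdiff (closedBall_subset_closedBall (hRm j.le_succ)) F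
    refine (hcont ((A j).indicator F) ?_ ?_ ⟨R (j + 1), fun ξ hξ => ?_⟩ _ (by positivity)).trans
      (ENNReal.ofReal_le_ofReal ?_)
    · rw [hdiff]
      exact (integrable_indicator_closedBall hF2 _).sub (integrable_indicator_closedBall hF2 _)
    · rw [hind]
      exact hFs.indicator (hAm j)
    · exact indicator_of_notMem (fun h => hξ.not_ge (by simpa using h.1)) F
    · gcongr
      rw [div_pow, div_le_iff₀ (by positivity), ← pow_mul, mul_comm j 2, pow_mul, ← mul_pow]
      exact (hnorm j).trans_eq (by norm_num)
  have hzero : hausdorffContent n α (limsup S atTop) = 0 := by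
    refine measure_limsup_atTop_eq_zero (ne_top_of_le_ne_top ?_ (ENNReal.tsum_le_tsum hS))
    rw [← ENNReal.ofReal_tsum_of_nonneg (fun _ => by positivity)
      (summable_geometric_two.mul_left K)]
    exact ENNReal.ofReal_ne_top
  refine measure_mono_null ?_ (hausdorffMeasure_eq_zero_of_hausdorffContent_eq_zero hα hzero)
  rintro x ⟨hx, hcell⟩
  rw [mem_limsup_iff_frequently_mem]
  by_contra hfreq
  refine notMem_schroDivergenceSet ψ hF2 hR1 hRm hR ?_ hx
  filter_upwards [not_frequently.1 hfreq] with j hj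
  exact not_lt.1 fun hlt => hj ⟨hcell, hlt⟩

/-- Translating the data by a modulation on the Fourier side. -/
lemma mem_schroDivergenceSet_add_iff (ψ : SchwartzMap ℝ ℝ) (F : EuclideanSpace ℝ (Fin n) → ℂ)
    (x y : EuclideanSpace ℝ (Fin n)) :
    x + y ∈ schroDivergenceSet n ψ F ↔
      y ∈ schroDivergenceSet n ψ fun ξ => F ξ * schroPhase n 0 x ξ := by
  have hp : schroPartial n ψ F (x + y) =
      schroPartial n ψ (fun ξ => F ξ * schroPhase n 0 x ξ) y := by
    funext t N
    rw [schroPartial_eq_freeEvol, schroPartial_eq_freeEvol, freeEvol_space_add]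
    simp only [mul_assoc]
  simp only [schroDivergenceSet, schroSol, Set.mem_ofPred_eq, hp]

/-- A maximal estimate in dimension `α` makes the divergence set a null set for the
`α`-dimensional Hausdorff measure. -/
lemma SchwartzMaximalBound.hausdorffMeasure_schroDivergenceSet (h : SchwartzMaximalBound n s α C)
    (hn : 1 ≤ n) (hs : 0 ≤ s) (hC : 0 ≤ C) (hα : 0 < α) (hαn : α ≤ n) (ψ : SchwartzMap ℝ ℝ)
    (hF : AEStronglyMeasurable F)
    (hFs : Integrable fun ξ => (1 + ‖ξ‖ ^ 2) ^ s * ‖F ξ‖ ^ 2) :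
    (μH[α] : Measure (EuclideanSpace ℝ (Fin n))) (schroDivergenceSet n ψ F) = 0 := by
  set c : (Fin n → ℤ) → EuclideanSpace ℝ (Fin n) := fun k =>
    WithLp.toLp 2 fun i => k i * dyadicSide n 0 with hc
  have hsub : schroDivergenceSet n ψ F ⊆ ⋃ k : Fin n → ℤ, IsometryEquiv.subRight (c k) ⁻¹'
      ((schroDivergenceSet n ψ fun ξ => F ξ * schroPhase n 0 (c k) ξ) ∩ dyadicCell n 0 0) := by
    intro x hx
    refine mem_iUnion.2 ⟨dyadicIndex n 0 x, ?_, ?_⟩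
    · rw [IsometryEquiv.subRight_apply, ← mem_schroDivergenceSet_add_iff, add_sub_cancel]
      exact hx
    · rw [IsometryEquiv.subRight_apply, mem_dyadicCell_iff hn]
      intro i
      have := (mem_dyadicCell_iff hn 0 (dyadicIndex n 0 x) x).1 rfl i
      simp only [hc, PiLp.sub_apply, Pi.zero_apply, Int.cast_zero, zero_mul, zero_add, mem_Ico] at this ⊢
      exact ⟨by linarith [this.1], by linarith [this.2]⟩
  refine measure_mono_null hsub (measure_iUnion_null fun k => ?_)
  rw [IsometryEquiv.hausdorffMeasure_preimage]
  exact h.hausdorffMeasure_inter_dyadicCell hn hs hC hα hαn ψ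
    (hF.mul (continuous_schroPhase_freq 0 (c k)).aestronglyMeasurable) (by simpa using hFs)

end divergence

theorem stmt12 (n : ℕ) (hn : 1 ≤ n) (s α₀ : ℝ) (hs : 0 < s)
    (hα₀ : (n : ℝ) - 2 * s ≤ α₀) (hα₀n : α₀ < n)
    (hmax : ∀ α : ℝ, α₀ < α → α ≤ n →
      ∃ C : ℝ, 0 < C ∧
        ∀ u₀ : SchwartzMap (EuclideanSpace ℝ (Fin n)) ℂ,
        ∀ μ : Measure (EuclideanSpace ℝ (Fin n)), IsAlphaDimensional n α μ →
          ∫⁻ x, (⨆ (t : ℝ) (_ : t ∈ Ioo (0 : ℝ) 1),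
              ENNReal.ofReal ‖schroEvol n u₀ t x‖) ∂μ
            ≤ ENNReal.ofReal (C *
                Real.sqrt ((cAlpha n α μ).toReal * (μ univ).toReal) *
                hsNormOfHat n s (hatFn n (⇑u₀)))) :
    ∀ (ψ : SchwartzMap ℝ ℝ), (∀ y, 0 < ψ y) → ψ 0 = (2 * Real.pi) ^ (-(n : ℝ) / 2) →
    ∀ F : EuclideanSpace ℝ (Fin n) → ℂ, AEStronglyMeasurable F volume →
      Integrable (fun ξ => (1 + ‖ξ‖ ^ 2) ^ s * ‖F ξ‖ ^ 2) volume →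
      dimH (schroDivergenceSet n ψ F) ≤ ENNReal.ofReal α₀ := by
  intro ψ _ _ F hF hFs
  refine ENNReal.le_of_forall_pos_le_add fun ε hε _ => ?_
  have hn0 : (0 : ℝ) < n := by exact_mod_cast hn
  have hε' : (0 : ℝ) < ε := hε
  set α : ℝ := min n (max α₀ 0 + ε)
  have hα : 0 < α := lt_min hn0 (by linarith [le_max_right α₀ 0])
  have hα₀α : α₀ < α := lt_min hα₀n (by linarith [le_max_left α₀ 0])
  obtain ⟨C, hC, h⟩ := hmax α hα₀α (min_le_left _ _)
  have hzero := SchwartzMaximalBound.hausdorffMeasure_schroDivergenceSet (C := C) h hn hs.le hC.le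
    hα (min_le_left _ _) ψ hF hFs
  calc dimH (schroDivergenceSet n ψ F) ≤ (α.toNNReal : ℝ≥0∞) := by
        refine dimH_le_of_hausdorffMeasure_ne_top ?_
        rw [Real.coe_toNNReal α hα.le, hzero]
        exact ENNReal.zero_ne_top
    _ ≤ ENNReal.ofReal (max α₀ 0 + ε) := ENNReal.ofReal_le_ofReal (min_le_right _ _)
    _ = ENNReal.ofReal α₀ + ε := by
        rw [ENNReal.ofReal_add (le_max_right _ _) hε'.le, ENNReal.ofReal_coe_nnreal,
          ENNReal.ofReal_max, ENNReal.ofReal_zero, max_eq_left (by positivity)]
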